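/- Let X ⊆ ℂ^N be an n-dimensional analytic subset singular at the origin, given local coordinates (z'; z'') = (z_1,…,z_n; z_{n+1},…,z_N) with |z''| ≤ C|z'| on X near 0 for some C > 0. Then for every n+1 ≤ k ≤ N, the function |z_k|^2 / |z'|^{2n} is integrable on X near 0 with respect to the induced volume form. -/

import Mathlib

open MeasureTheory

/-- `X` is an analytic subset of `D`: locally on `D` it is the common zero set of finitely
many holomorphic functions. -/
def IsAnalyticIn {N : ℕ} (X D : Set (Fin N → ℂ)) : Prop :=
  X ⊆ D ∧ ∀ x ∈ D, ∃ U ∈ nhds x, U ⊆ D ∧ ∃ (r : ℕ) (f : Fin r → (Fin N → ℂ) → ℂ),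
    (∀ i, DifferentiableOn ℂ (f i) U) ∧ X ∩ U = {z ∈ U | ∀ i, f i z = 0}

/-- `X` has pure (complex) dimension `n`: near every point of `X` it has Hausdorff
dimension `2n`. -/
def IsPureDimensional {N : ℕ} (X : Set (Fin N → ℂ)) (n : ℕ) : Prop :=
  ∀ x ∈ X, ∀ U ∈ nhds x, dimH (X ∩ U) = (2 * n : ℕ)



open Filter Topology Set Metric in
/-- holomorphic near a point -/
def HolAt {E F : Type*} [NormedAddCommGroup E] [NormedSpace ℂ E] [NormedAddCommGroup F]
    [NormedSpace ℂ F] (f : E → F) (x : E) : Prop :=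
  ∀ᶠ y in nhds x, DifferentiableAt ℂ f y

section holbasic
open Filter Topology Set Metric

variable {E F G : Type*} [NormedAddCommGroup E] [NormedSpace ℂ E] [NormedAddCommGroup F]
    [NormedSpace ℂ F] [NormedAddCommGroup G] [NormedSpace ℂ G]

theorem HolAt.eventually {f : E → F} {x : E} (h : HolAt f x) : ∀ᶠ y in 𝓝 x, HolAt f y :=
  eventually_eventually_nhds.2 h

theorem HolAt.diff {f : E → F} {x : E} (h : HolAt f x) : DifferentiableAt ℂ f x :=
  h.self_of_nhds

theorem HolAt.congr {f g : E → F} {x : E} (h : HolAt f x) (hfg : f =ᶠ[𝓝 x] g) : HolAt g x := by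
  filter_upwards [h, eventually_eventually_nhds.2 hfg] with y hy hy2
  exact hy.congr_of_eventuallyEq (EventuallyEq.symm hy2)

theorem HolAt.comp {g : F → G} {f : E → F} {x : E} (hg : HolAt g (f x)) (hf : HolAt f x) :
    HolAt (fun y => g (f y)) x := by
  filter_upwards [hf, hf.diff.continuousAt.eventually hg] with y hy hy2
  exact DifferentiableAt.comp y hy2 hy

theorem holAt_const (c : F) (x : E) : HolAt (fun _ => c) x :=
  Eventually.of_forall fun _ => differentiableAt_const c

theorem holAt_of_differentiable {f : E → F} (hf : Differentiable ℂ f) (x : E) : HolAt f x :=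
  Eventually.of_forall fun y => hf y

theorem HolAt.mul {f g : E → ℂ} {x : E} (hf : HolAt f x) (hg : HolAt g x) :
    HolAt (fun y => f y * g y) x := by
  filter_upwards [hf, hg] with y h1 h2 using h1.mul h2

theorem HolAt.add {f g : E → F} {x : E} (hf : HolAt f x) (hg : HolAt g x) :
    HolAt (fun y => f y + g y) x := by
  filter_upwards [hf, hg] with y h1 h2 using h1.add h2

theorem HolAt.sub {f g : E → F} {x : E} (hf : HolAt f x) (hg : HolAt g x) :
    HolAt (fun y => f y - g y) x := by
  filter_upwards [hf, hg] with y h1 h2 using h1.sub h2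

theorem HolAt.pow {f : E → ℂ} {x : E} (hf : HolAt f x) (k : ℕ) :
    HolAt (fun y => f y ^ k) x := by
  filter_upwards [hf] with y h1 using h1.pow k

theorem HolAt.sum {ι : Type*} {s : Finset ι} {f : ι → E → F} {x : E}
    (hf : ∀ i ∈ s, HolAt (f i) x) : HolAt (fun y => ∑ i ∈ s, f i y) x := by
  have : ∀ᶠ y in 𝓝 x, ∀ i ∈ s, DifferentiableAt ℂ (f i) y :=
    (Filter.eventually_all_finset s).2 hf
  filter_upwards [this] with y hy
  exact DifferentiableAt.fun_sum hy

/-- holomorphic functions have continuous derivative -/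
theorem HolAt.continuousAt_fderiv {f : E → F} {x : E} (hf : HolAt f x) :
    ContinuousAt (fderiv ℂ f) x := by
  -- a ball where differentiable and bounded
  have hb : ∀ᶠ y in 𝓝 x, ‖f y - f x‖ < 1 := by
    have := hf.diff.continuousAt
    have h2 := Metric.tendsto_nhds.1 this 1 one_pos
    simpa [dist_eq_norm] using h2
  obtain ⟨R, hR, hRb⟩ := Metric.eventually_nhds_iff_ball.1 (hf.and hb)
  -- Lipschitz on the ball of radius R/2
  have hder : ∀ y ∈ ball x (R/2), ‖fderiv ℂ f y‖ ≤ 2 / (R/2) := by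
    intro y hy
    have hsub : ball y (R/2) ⊆ ball x R := by
      apply ball_subset_ball'
      have := mem_ball.1 hy
      linarith
    apply Complex.norm_fderiv_le_div_of_mapsTo_ball (R₁ := R/2) (R₂ := 2) _ _ (by positivity)
    · intro z hz
      exact (hRb z (hsub hz)).1.differentiableWithinAt
    · intro z hz
      have h1 := (hRb z (hsub hz)).2
      have h2 := (hRb y (hsub (mem_ball_self (by positivity)))).2
      rw [mem_closedBall, dist_eq_norm]
      calc ‖f z - f y‖ = ‖(f z - f x) - (f y - f x)‖ := by congr 1; abel
        _ ≤ ‖f z - f x‖ + ‖f y - f x‖ := norm_sub_le _ _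
        _ ≤ 2 := by linarith
  have hlip : ∀ y ∈ ball x (R/2), ∀ z ∈ ball x (R/2), ‖f z - f y‖ ≤ 2 / (R/2) * ‖z - y‖ := by
    intro y hy z hz
    apply (convex_ball x (R/2)).norm_image_sub_le_of_norm_fderiv_le (𝕜 := ℂ) _ hder hy hz
    intro w hw
    exact (hRb w (ball_subset_ball (by linarith) hw)).1
  -- now derivative estimate
  have key : ∀ y ∈ ball x (R/8), ‖fderiv ℂ f y - fderiv ℂ f x‖ ≤
      (2 * (2 / (R/2) * ‖y - x‖)) / (R/8) := by
    intro y hy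
    set g : E → F := fun z => f (z + (y - x)) - f z with hg
    have hyR : ‖y - x‖ < R/8 := by simpa [dist_eq_norm] using hy
    have hin : ∀ z ∈ ball x (R/8), z ∈ ball x (R/2) ∧ z + (y - x) ∈ ball x (R/2) := by
      intro z hz
      rw [mem_ball, dist_eq_norm] at hz
      constructor
      · rw [mem_ball, dist_eq_norm]; linarith
      · rw [mem_ball, dist_eq_norm]
        calc ‖z + (y - x) - x‖ = ‖(z - x) + (y - x)‖ := by congr 1; abel
          _ ≤ ‖z - x‖ + ‖y - x‖ := norm_add_le _ _
          _ < R / 2 := by linarith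
    have hdf : ∀ w ∈ ball x (R/2), DifferentiableAt ℂ f w := fun w hw =>
      (hRb w (ball_subset_ball (by linarith) hw)).1
    have hdg : ∀ z ∈ ball x (R/8), HasFDerivAt g (fderiv ℂ f (z + (y - x)) - fderiv ℂ f z) z := by
      intro z hz
      have h1 := (hdf _ (hin z hz).2).hasFDerivAt
      have h2 := (hdf _ (hin z hz).1).hasFDerivAt
      have h3 : HasFDerivAt (fun z => f (z + (y - x))) (fderiv ℂ f (z + (y - x))) z := by
        simpa [Function.comp_def] using h1.comp z ((hasFDerivAt_id z).add_const (y - x))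
      exact h3.sub h2
    have hx : x ∈ ball x (R/8) := mem_ball_self (by positivity)
    have heq : fderiv ℂ g x = fderiv ℂ f y - fderiv ℂ f x := by
      rw [(hdg x hx).fderiv]; simp
    rw [← heq]
    have hgb : ∀ z ∈ ball x (R/8), ‖g z‖ ≤ 2 / (R/2) * ‖y - x‖ := by
      intro z hz
      have := hlip z (hin z hz).1 _ (hin z hz).2
      simpa [hg] using this
    apply Complex.norm_fderiv_le_div_of_mapsTo_ball _ _ (by positivity)
    · intro z hz
      exact (hdg z hz).differentiableAt.differentiableWithinAt
    · intro z hz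
      rw [mem_closedBall, dist_eq_norm]
      have h1 := hgb z hz
      have h2 := hgb x hx
      calc ‖g z - g x‖ ≤ ‖g z‖ + ‖g x‖ := norm_sub_le _ _
        _ ≤ _ := by linarith
  rw [ContinuousAt, tendsto_iff_norm_sub_tendsto_zero]
  have hlim : Tendsto (fun y => (2 * (2 / (R/2) * ‖y - x‖)) / (R/8)) (𝓝 x) (𝓝 0) := by
    have : Continuous fun y : E => (2 * (2 / (R/2) * ‖y - x‖)) / (R/8) := by fun_prop
    have := this.tendsto x
    simpa using this
  apply squeeze_zero' (Eventually.of_forall fun _ => norm_nonneg _) _ hlim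
  filter_upwards [ball_mem_nhds x (show 0 < R/8 by positivity)] with y hy using key y hy

theorem HolAt.contDiffAt {f : E → F} {x : E} (hf : HolAt f x) : ContDiffAt ℂ 1 f x := by
  rw [contDiffAt_one_iff]
  refine ⟨fderiv ℂ f, {y | HolAt f y}, hf.eventually, ?_, ?_⟩
  · intro y hy
    exact hy.continuousAt_fderiv.continuousWithinAt
  · intro y hy
    exact hy.diff.hasFDerivAt

theorem HolAt.hasStrictFDerivAt {f : E → F} {x : E} (hf : HolAt f x) :
    HasStrictFDerivAt f (fderiv ℂ f x) x :=
  hf.contDiffAt.hasStrictFDerivAt (by simp)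

/-- the partial derivative in the last variable -/
theorem HolAt.partial {Y : Type*} [NormedAddCommGroup Y] [NormedSpace ℂ Y] {f : Y × ℂ → ℂ}
    {y : Y} {w : ℂ} (hf : HolAt f (y, w)) :
    HasDerivAt (fun w => f (y, w)) (fderiv ℂ f (y, w) (0, 1)) w := by
  have h1 := hf.diff.hasFDerivAt
  have h2 : HasDerivAt (fun w : ℂ => (y, w)) ((0 : Y), (1 : ℂ)) w :=
    (hasDerivAt_const w y).prodMk (hasDerivAt_id w)
  exact h1.comp_hasDerivAt w h2

end holbasic

section holint
open Filter Topology Set Metric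

variable {Y : Type*} [NormedAddCommGroup Y] [NormedSpace ℂ Y]

theorem differentiableAt_circleIntegral {Φ : Y × ℂ → ℂ} {y₀ : Y} {ρ : ℝ} (hρ : 0 ≤ ρ)
    (h : ∀ ζ ∈ sphere (0 : ℂ) ρ, HolAt Φ (y₀, ζ)) :
    DifferentiableAt ℂ (fun y => ∮ ζ in C(0, ρ), Φ (y, ζ)) y₀ := by
  have hK : IsCompact (sphere (0 : ℂ) ρ) := isCompact_sphere 0 ρ
  have hcont : ∀ ζ ∈ sphere (0 : ℂ) ρ, ContinuousAt (fun z => fderiv ℂ Φ (y₀, z)) ζ := by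
    intro ζ hζ
    have h1 := (h ζ hζ).continuousAt_fderiv
    exact ContinuousAt.comp (f := fun z : ℂ => (y₀, z)) h1 (by fun_prop)
  obtain ⟨M, hM⟩ := hK.exists_bound_of_continuousOn
    (f := fun z => fderiv ℂ Φ (y₀, z)) (fun ζ hζ => (hcont ζ hζ).continuousWithinAt)
  have hev : ∀ᶠ y in 𝓝 y₀, ∀ ζ ∈ sphere (0 : ℂ) ρ, HolAt Φ (y, ζ) ∧ ‖fderiv ℂ Φ (y, ζ)‖ < M + 1 := by
    apply hK.eventually_forall_of_forall_eventually
    intro ζ hζ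
    have h1 := (h ζ hζ).eventually
    have h2 : ∀ᶠ z in 𝓝 (y₀, ζ), ‖fderiv ℂ Φ z‖ < M + 1 := by
      apply (h ζ hζ).continuousAt_fderiv.norm.eventually_lt continuousAt_const
      have := hM ζ hζ
      linarith
    exact h1.and h2
  have hsph : ∀ θ : ℝ, circleMap 0 ρ θ ∈ sphere (0 : ℂ) ρ := fun θ => circleMap_mem_sphere 0 hρ θ
  have hself := hev.self_of_nhds
  have hc1 : ∀ y, (∀ ζ ∈ sphere (0 : ℂ) ρ, HolAt Φ (y, ζ)) →
      Continuous fun θ : ℝ => deriv (circleMap 0 ρ) θ • Φ (y, circleMap 0 ρ θ) := by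
    intro y hy
    apply Continuous.fun_smul
    · have : deriv (circleMap 0 ρ) = fun θ => circleMap 0 ρ θ * Complex.I := by
        funext θ; exact deriv_circleMap 0 ρ θ
      rw [this]; fun_prop
    · rw [continuous_iff_continuousAt]
      intro θ
      have h1 := (hy _ (hsph θ)).diff.continuousAt
      exact ContinuousAt.comp (f := fun θ : ℝ => (y, circleMap 0 ρ θ)) h1 (by fun_prop)
  have hmain := intervalIntegral.hasFDerivAt_integral_of_dominated_of_fderiv_le (𝕜 := ℂ)
    (μ := volume) (a := 0) (b := 2 * Real.pi) (x₀ := y₀)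
    (F := fun y θ => deriv (circleMap 0 ρ) θ • Φ (y, circleMap 0 ρ θ))
    (F' := fun y θ => deriv (circleMap 0 ρ) θ •
      (fderiv ℂ Φ (y, circleMap 0 ρ θ)).comp (ContinuousLinearMap.inl ℂ Y ℂ))
    (s := {y | ∀ ζ ∈ sphere (0 : ℂ) ρ, HolAt Φ (y, ζ) ∧ ‖fderiv ℂ Φ (y, ζ)‖ < M + 1})
    (bound := fun _ => ρ * ((M + 1) * 1)) hev ?_ ?_ ?_ ?_ ?_ ?_
  · exact hmain.differentiableAt
  · filter_upwards [hev] with y hy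
    exact (hc1 y fun ζ hζ => (hy ζ hζ).1).aestronglyMeasurable
  · exact (hc1 y₀ fun ζ hζ => (hself ζ hζ).1).intervalIntegrable _ _
  · apply Continuous.aestronglyMeasurable
    apply Continuous.fun_smul
    · have : deriv (circleMap 0 ρ) = fun θ => circleMap 0 ρ θ * Complex.I := by
        funext θ; exact deriv_circleMap 0 ρ θ
      rw [this]; fun_prop
    · apply Continuous.clm_comp _ continuous_const
      rw [continuous_iff_continuousAt]
      intro θ
      exact ContinuousAt.comp (f := fun θ : ℝ => circleMap 0 ρ θ) (hcont _ (hsph θ)) (by fun_prop)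
  · refine Eventually.of_forall fun θ _ y hy => ?_
    rw [norm_smul]
    have h1 : ‖deriv (circleMap 0 ρ) θ‖ = ρ := by
      simp [deriv_circleMap, abs_of_nonneg hρ]
    rw [h1]
    apply mul_le_mul_of_nonneg_left _ hρ
    refine (ContinuousLinearMap.opNorm_comp_le _ _).trans ?_
    apply mul_le_mul (hy _ (hsph θ)).2.le (ContinuousLinearMap.norm_inl_le_one ℂ Y ℂ)
      (norm_nonneg _)
    exact (norm_nonneg _).trans (hy _ (hsph θ)).2.le
  · simp
  · refine Eventually.of_forall fun θ _ y hy => ?_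
    have h1 := (hy _ (hsph θ)).1.diff.hasFDerivAt
    have h2 : HasFDerivAt (fun y : Y => (y, circleMap 0 ρ θ)) (ContinuousLinearMap.inl ℂ Y ℂ) y :=
      hasFDerivAt_prodMk_left y _
    exact (h1.comp y h2).fun_const_smul _

theorem holAt_circleIntegral {Φ : Y × ℂ → ℂ} {y₀ : Y} {ρ : ℝ} (hρ : 0 ≤ ρ)
    (h : ∀ ζ ∈ sphere (0 : ℂ) ρ, HolAt Φ (y₀, ζ)) :
    HolAt (fun y => ∮ ζ in C(0, ρ), Φ (y, ζ)) y₀ := by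
  have hK : IsCompact (sphere (0 : ℂ) ρ) := isCompact_sphere 0 ρ
  have hev : ∀ᶠ y in 𝓝 y₀, ∀ ζ ∈ sphere (0 : ℂ) ρ, HolAt Φ (y, ζ) := by
    apply hK.eventually_forall_of_forall_eventually
    intro ζ hζ
    exact (h ζ hζ).eventually
  filter_upwards [hev] with y hy
  exact differentiableAt_circleIntegral hρ hy

/-- the partial derivative is holomorphic -/
theorem HolAt.partial_hol {f : Y × ℂ → ℂ} {x : Y × ℂ} (hf : HolAt f x) :
    HolAt (fun x : Y × ℂ => deriv (fun w => f (x.1, w)) x.2) x := by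
  obtain ⟨R, hR, hb⟩ := Metric.eventually_nhds_iff_ball.1 hf
  have hin : ∀ z ∈ ball x (R/2), ∀ ξ : ℂ, ‖ξ‖ ≤ R / 4 → HolAt f (z.1, z.2 + ξ) := by
    intro z hz ξ hξ
    have : (z.1, z.2 + ξ) ∈ ball x R := by
      rw [mem_ball] at hz ⊢
      have h1 : dist (z.1, z.2 + ξ) z ≤ R / 4 := by
        rw [Prod.dist_eq]
        simp
        exact hξ
      linarith [dist_triangle (z.1, z.2 + ξ) z x]
    filter_upwards [isOpen_ball.mem_nhds this] with y hy using hb y hy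
  have hI : HolAt (fun z : Y × ℂ => (2 * Real.pi * Complex.I : ℂ)⁻¹ *
      ∮ ξ in C(0, R/4), (ξ ^ 2)⁻¹ * f (z.1, z.2 + ξ)) x := by
    apply (holAt_const _ _).mul
    apply holAt_circleIntegral (Φ := fun q : (Y × ℂ) × ℂ => (q.2 ^ 2)⁻¹ * f (q.1.1, q.1.2 + q.2))
      (by positivity)
    intro ζ hζ
    have hζ' : ‖ζ‖ = R / 4 := by simpa using hζ
    have hζ0 : ζ ≠ 0 := by
      intro h; rw [h] at hζ'; simp at hζ'; linarith
    apply HolAt.mul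
    · have : ∀ᶠ q : (Y × ℂ) × ℂ in 𝓝 (x, ζ), q.2 ≠ 0 :=
        continuous_snd.continuousAt.eventually_ne hζ0
      filter_upwards [this] with q hq
      apply DifferentiableAt.inv (by fun_prop) (by simpa using hq)
    · have h1 := hin x (mem_ball_self (by positivity)) ζ hζ'.le
      exact HolAt.comp (f := fun q : (Y × ℂ) × ℂ => (q.1.1, q.1.2 + q.2)) (x := (x, ζ)) h1
        (holAt_of_differentiable (by fun_prop) _)
  refine hI.congr ?_
  filter_upwards [ball_mem_nhds x (show 0 < R/2 by positivity)] with z hz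
  have hd : DiffContOnCl ℂ (fun ξ => f (z.1, z.2 + ξ)) (ball 0 (R/4)) := by
    apply DifferentiableOn.diffContOnCl
    rw [closure_ball _ (by positivity)]
    intro ξ hξ
    have h1 := (hin z hz ξ (by simpa using hξ)).diff
    exact (DifferentiableAt.comp (f := fun ξ : ℂ => (z.1, z.2 + ξ)) ξ h1
      (by fun_prop)).differentiableWithinAt
  have hc := hd.deriv_eq_smul_circleIntegral (c := 0) (R := R/4) (by positivity)
  have h0 : deriv (fun ξ => f (z.1, z.2 + ξ)) 0 = deriv (fun w => f (z.1, w)) z.2 := by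
    have := deriv_comp_const_add (f := fun w => f (z.1, w)) z.2 0
    simpa using this
  rw [← h0, eq_comm]
  simp only [sub_zero, one_div, smul_eq_mul] at hc
  rw [hc, inv_mul_cancel_left₀]
  simp [Real.pi_ne_zero]

end holint

section factor
open Filter Topology Set Metric

theorem HolAt.analyticAt {f : ℂ → ℂ} {x : ℂ} (hf : HolAt f x) : AnalyticAt ℂ f x :=
  Complex.analyticAt_iff_eventually_differentiableAt.2 hf

theorem AnalyticAt.holAt' {f : ℂ → ℂ} {x : ℂ} (hf : AnalyticAt ℂ f x) : HolAt f x :=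
  Complex.analyticAt_iff_eventually_differentiableAt.1 hf

theorem factor_aux (ρ : ℝ) (n : ℕ) : ∀ f : ℂ → ℂ, (∀ w ∈ closedBall (0 : ℂ) ρ, AnalyticAt ℂ f w) →
    (∀ w ∈ sphere (0 : ℂ) ρ, f w ≠ 0) → (Z : Finset ℂ) →
    (∀ w, w ∈ Z ↔ w ∈ closedBall (0 : ℂ) ρ ∧ f w = 0) → Z.card = n →
    ∃ l : List ℂ, (∀ a ∈ l, a ∈ ball (0 : ℂ) ρ) ∧ ∃ e : ℂ → ℂ,
      (∀ w ∈ closedBall (0 : ℂ) ρ, AnalyticAt ℂ e w) ∧ (∀ w ∈ closedBall (0 : ℂ) ρ, e w ≠ 0) ∧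
      ∀ w, f w = (l.map (fun a => w - a)).prod * e w := by
  induction n with
  | zero =>
    intro f hf hs Z hZ hc
    refine ⟨[], by simp, f, hf, ?_, by simp⟩
    intro w hw h0
    have := (hZ w).2 ⟨hw, h0⟩
    rw [Finset.card_eq_zero.1 hc] at this
    simp at this
  | succ n ih =>
    intro f hf hs Z hZ hc
    obtain ⟨a, ha⟩ := Finset.card_pos.1 (by omega : 0 < Z.card)
    have ha1 := (hZ a).1 ha
    have haball : a ∈ ball (0 : ℂ) ρ := by
      by_contra hcon
      have : a ∈ sphere (0 : ℂ) ρ := by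
        simp only [mem_ball, mem_closedBall, mem_sphere] at *
        exact le_antisymm ha1.1 (not_lt.1 hcon)
      exact hs a this ha1.2
    have hnz : ¬ ∀ᶠ z in 𝓝 a, f z = 0 := by
      intro hcon
      have hmem : (Z : Set ℂ) ∈ 𝓝 a := by
        filter_upwards [hcon, isOpen_ball.mem_nhds haball] with z hz hz2
        exact (hZ z).2 ⟨ball_subset_closedBall hz2, hz⟩
      exact infinite_of_mem_nhds a hmem Z.finite_toSet
    obtain ⟨k, g, hg, hga, hfg⟩ :=
      (hf a ha1.1).exists_eventuallyEq_pow_smul_nonzero_iff.2 hnz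
    have hk : k ≠ 0 := by
      rintro rfl
      have := hfg.self_of_nhds
      rw [ha1.2] at this
      simp at this
      exact hga this.symm
    set G : ℂ → ℂ := fun w => if w = a then g a else f w / (w - a) ^ k with hG
    have hGeq : G =ᶠ[𝓝 a] g := by
      filter_upwards [hfg] with w hw
      by_cases hwa : w = a
      · simp [hG, hwa]
      · have : (w - a) ^ k ≠ 0 := pow_ne_zero _ (sub_ne_zero.2 hwa)
        simp only [hG, if_neg hwa, hw, smul_eq_mul]
        field_simp
    have hfG : ∀ w, f w = (w - a) ^ k * G w := by
      intro w
      by_cases hwa : w = a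
      · simp [hwa, ha1.2, hk]
      · have : (w - a) ^ k ≠ 0 := pow_ne_zero _ (sub_ne_zero.2 hwa)
        simp only [hG, if_neg hwa]
        field_simp
    have hGan : ∀ w ∈ closedBall (0 : ℂ) ρ, AnalyticAt ℂ G w := by
      intro w hw
      by_cases hwa : w = a
      · rw [hwa]; exact hg.congr hGeq.symm
      · have h1 : AnalyticAt ℂ (fun w => f w / (w - a) ^ k) w :=
          (hf w hw).fun_div (by fun_prop) (pow_ne_zero _ (sub_ne_zero.2 hwa))
        apply h1.congr
        filter_upwards [isOpen_ne.mem_nhds hwa] with z hz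
        have : z ≠ a := hz
        simp [hG, this]
    have hGa : G a ≠ 0 := by simpa [hG] using hga
    obtain ⟨l, hl, e, he, he0, hle⟩ := ih G hGan (by
        intro w hw h0
        apply hs w hw
        rw [hfG, h0, mul_zero]) (Z.erase a) (by
        intro w
        rw [Finset.mem_erase, hZ, hfG w]
        constructor
        · rintro ⟨h1, h2, h3⟩
          refine ⟨h2, ?_⟩
          rcases mul_eq_zero.1 h3 with h4 | h4
          · exact absurd (sub_eq_zero.1 (pow_eq_zero_iff hk |>.1 h4)) h1
          · exact h4
        · rintro ⟨h1, h2⟩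
          refine ⟨?_, h1, by rw [h2, mul_zero]⟩
          rintro rfl
          exact hGa h2) (by rw [Finset.card_erase_of_mem ha, hc]; rfl)
    refine ⟨List.replicate k a ++ l, ?_, e, he, he0, ?_⟩
    · intro b hb
      rcases List.mem_append.1 hb with h | h
      · rw [List.eq_of_mem_replicate h]; exact haball
      · exact hl b h
    · intro w
      rw [hfG, hle]
      simp [mul_assoc]

theorem factor_disc {ρ : ℝ} (hρ : 0 < ρ) {f : ℂ → ℂ}
    (hf : ∀ w ∈ closedBall (0 : ℂ) ρ, AnalyticAt ℂ f w)
    (hs : ∀ w ∈ sphere (0 : ℂ) ρ, f w ≠ 0) :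
    ∃ l : List ℂ, (∀ a ∈ l, a ∈ ball (0 : ℂ) ρ) ∧ ∃ e : ℂ → ℂ,
      (∀ w ∈ closedBall (0 : ℂ) ρ, AnalyticAt ℂ e w) ∧ (∀ w ∈ closedBall (0 : ℂ) ρ, e w ≠ 0) ∧
      ∀ w, f w = (l.map (fun a => w - a)).prod * e w := by
  have hfin : {w | w ∈ closedBall (0 : ℂ) ρ ∧ f w = 0}.Finite := by
    by_contra hinf
    obtain ⟨x, hx, hacc⟩ := Set.Infinite.exists_accPt_of_subset_isCompact hinf
      (isCompact_closedBall (0 : ℂ) ρ) (fun w hw => hw.1)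
    have hfr : ∃ᶠ z in 𝓝[≠] x, f z = 0 := by
      rw [accPt_iff_frequently_nhdsNE] at hacc
      exact hacc.mono fun z hz => hz.2
    have hzero := AnalyticOnNhd.eqOn_zero_of_preconnected_of_frequently_eq_zero
      (f := f) (U := closedBall (0 : ℂ) ρ) hf (convex_closedBall _ _).isPreconnected hx hfr
    have hmem : (ρ : ℂ) ∈ sphere (0 : ℂ) ρ := by simp [abs_of_pos hρ]
    exact hs _ hmem (hzero (sphere_subset_closedBall hmem))
  exact factor_aux ρ _ f hf hs hfin.toFinset (by intro w; simp) rfl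

theorem sum_roots_integral {ρ : ℝ} (hρ : 0 < ρ) {g e : ℂ → ℂ}
    (hg : ∀ w ∈ closedBall (0 : ℂ) ρ, AnalyticAt ℂ g w)
    (he : ∀ w ∈ closedBall (0 : ℂ) ρ, AnalyticAt ℂ e w)
    (he0 : ∀ w ∈ closedBall (0 : ℂ) ρ, e w ≠ 0) (l : List ℂ) (hl : ∀ a ∈ l, a ∈ ball (0 : ℂ) ρ) :
    (∮ w in C(0, ρ), g w * logDeriv (fun w => (l.map (fun a => w - a)).prod * e w) w) =
      2 * Real.pi * Complex.I * (l.map g).sum := by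
  have hgd : DiffContOnCl ℂ g (ball 0 ρ) := by
    apply DifferentiableOn.diffContOnCl
    rw [closure_ball _ hρ.ne']
    exact fun w hw => (hg w hw).differentiableAt.differentiableWithinAt
  induction l with
  | nil =>
    simp only [List.map_nil, List.prod_nil, one_mul, List.sum_nil, mul_zero]
    apply DiffContOnCl.circleIntegral_eq_zero hρ.le
    apply DifferentiableOn.diffContOnCl
    rw [closure_ball _ hρ.ne']
    intro w hw
    have h1 : AnalyticAt ℂ (fun w => g w * (deriv e w / e w)) w :=
      (hg w hw).fun_mul ((he w hw).deriv.fun_div (he w hw) (he0 w hw))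
    exact h1.differentiableAt.differentiableWithinAt
  | cons a l ih =>
    have ih' := ih (fun b hb => hl b (List.mem_cons_of_mem _ hb))
    have ha := hl a (List.mem_cons_self)
    set P : ℂ → ℂ := fun w => (l.map (fun a => w - a)).prod * e w with hP
    have hPan : ∀ w ∈ closedBall (0 : ℂ) ρ, AnalyticAt ℂ P w := by
      intro w hw
      refine AnalyticAt.fun_mul ?_ (he w hw)
      have : Differentiable ℂ fun w : ℂ => (l.map (fun a => w - a)).prod := by
        clear * -
        induction l with
        | nil => simp
        | cons b l ih => simp only [List.map_cons, List.prod_cons]; fun_prop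
      exact this.analyticAt w
    have hne : ∀ w ∈ sphere (0 : ℂ) ρ, ∀ b ∈ ball (0 : ℂ) ρ, w - b ≠ 0 := by
      intro w hw b hb h
      rw [sub_eq_zero.1 h] at hw
      simp at hw hb
      linarith
    have hP0 : ∀ w ∈ sphere (0 : ℂ) ρ, P w ≠ 0 := by
      intro w hw
      apply mul_ne_zero _ (he0 w (sphere_subset_closedBall hw))
      apply List.prod_ne_zero
      simp only [List.mem_map, not_exists, not_and]
      intro b hb
      exact hne w hw b (hl b (List.mem_cons_of_mem _ hb))
    have hcong : (∮ w in C(0, ρ), g w *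
        logDeriv (fun w => ((a :: l).map (fun a => w - a)).prod * e w) w) =
        ∮ w in C(0, ρ), ((w - a)⁻¹ • g w + g w * logDeriv P w) := by
      apply circleIntegral.integral_congr hρ.le
      intro w hw
      have hfun : (fun w => ((a :: l).map (fun a => w - a)).prod * e w) =
          fun w => (w - a) * P w := by
        funext w; simp [hP, mul_assoc]
      simp only [hfun]
      rw [logDeriv_mul (f := fun w => w - a) (g := P) w (hne w hw a ha) (hP0 w hw) (by fun_prop)
        (hPan w (sphere_subset_closedBall hw)).differentiableAt]
      simp only [logDeriv_apply, smul_eq_mul]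
      simp
      ring
    rw [hcong, circleIntegral.integral_add, ih', hgd.circleIntegral_sub_inv_smul ha]
    · simp [smul_eq_mul]; ring
    · apply ContinuousOn.circleIntegrable hρ.le
      intro w hw
      apply ContinuousAt.continuousWithinAt
      have h1 : AnalyticAt ℂ (fun w => (w - a)⁻¹ * g w) w :=
        AnalyticAt.fun_mul (AnalyticAt.fun_inv (by fun_prop) (hne w hw a ha))
          (hg w (sphere_subset_closedBall hw))
      exact h1.continuousAt
    · apply ContinuousOn.circleIntegrable hρ.le
      intro w hw
      apply ContinuousAt.continuousWithinAt
      have hw' := sphere_subset_closedBall hw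
      have h1 : AnalyticAt ℂ (fun w => g w * (deriv P w / P w)) w :=
        (hg w hw').fun_mul ((hPan w hw').deriv.fun_div (hPan w hw') (hP0 w hw))
      exact h1.continuousAt

end factor

section roots
open Filter Topology Set Metric

variable {Y : Type*} [NormedAddCommGroup Y] [NormedSpace ℂ Y]

theorem newton_hol {p : ℕ} (G : Y → Fin p → ℂ) (y₀ : Y)
    (h : ∀ k, HolAt (fun y => ∑ i, G y i ^ k) y₀) (k : ℕ) :
    HolAt (fun y => MvPolynomial.aeval (G y) (MvPolynomial.esymm (Fin p) ℂ k)) y₀ := by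
  induction k using Nat.strong_induction_on with
  | _ k ih =>
    rcases Nat.eq_zero_or_pos k with rfl | hk
    · simp only [MvPolynomial.esymm_zero, map_one]
      exact holAt_const _ _
    · have heq : ∀ y, MvPolynomial.aeval (G y) (MvPolynomial.esymm (Fin p) ℂ k) =
          (k : ℂ)⁻¹ * ((-1) ^ (k + 1) * ∑ a ∈ Finset.HasAntidiagonal.antidiagonal k with a.1 < k,
            (-1) ^ a.1 * MvPolynomial.aeval (G y) (MvPolynomial.esymm (Fin p) ℂ a.1) *
              ∑ i, G y i ^ a.2) := by
        intro y
        have h1 := congrArg (MvPolynomial.aeval (G y)) (MvPolynomial.mul_esymm_eq_sum (Fin p) ℂ k)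
        simp only [map_mul, map_natCast, map_pow, map_neg, map_one, map_sum,
          MvPolynomial.psum, MvPolynomial.aeval_X] at h1
        rw [← h1, inv_mul_cancel_left₀]
        exact_mod_cast hk.ne'
      simp only [heq]
      refine (holAt_const _ _).mul ((holAt_const _ _).mul (HolAt.sum fun a ha => ?_))
      rw [Finset.mem_filter] at ha
      exact ((holAt_const _ _).mul (ih a.1 ha.2)).mul (h a.2)

theorem HolAt.slice {F : Y × ℂ → ℂ} {y : Y} {w : ℂ} (h : HolAt F (y, w)) :
    AnalyticAt ℂ (fun w => F (y, w)) w :=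
  HolAt.analyticAt (HolAt.comp (f := fun w : ℂ => (y, w)) h (holAt_of_differentiable (by fun_prop) _))

theorem roots_lemma (F : Y × ℂ → ℂ) (hF : HolAt F (0, 0))
    (hne : ¬ ∀ᶠ w in 𝓝 (0 : ℂ), F (0, w) = 0) (ρ₀ : ℝ) (hρ₀ : 0 < ρ₀) :
    ∃ ρ, 0 < ρ ∧ ρ < ρ₀ ∧ ∃ (p : ℕ) (ζ : Y → Fin p → ℂ),
      (∀ᶠ y in 𝓝 (0 : Y), ∀ i, ‖ζ y i‖ < ρ) ∧
      (∀ᶠ y in 𝓝 (0 : Y), ∀ w, ‖w‖ < ρ → (F (y, w) = 0 ↔ ∃ i, ζ y i = w)) ∧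
      ∀ g : Y × ℂ → ℂ, (∀ w, ‖w‖ ≤ ρ → HolAt g (0, w)) → ∀ k,
        HolAt (fun y => MvPolynomial.aeval (fun i => g (y, ζ y i))
          (MvPolynomial.esymm (Fin p) ℂ k)) 0 := by
  have h0 : ∀ᶠ w in 𝓝[≠] (0 : ℂ), F (0, w) ≠ 0 :=
    (hF.slice.eventually_eq_zero_or_eventually_ne_zero).resolve_left hne
  rw [eventually_nhdsWithin_iff] at h0
  have h0' : ∀ᶠ w in 𝓝 (0 : ℂ), HolAt F (0, w) :=
    (Continuous.tendsto (f := fun w : ℂ => ((0 : Y), w)) (by fun_prop) 0).eventually hF.eventually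
  obtain ⟨R, hR, hRb⟩ := Metric.eventually_nhds_iff_ball.1 (h0.and h0')
  set ρ := min R ρ₀ / 2 with hρdef
  have hm : 0 < min R ρ₀ := lt_min hR hρ₀
  have hρ : 0 < ρ := by positivity
  have hρR : ρ < R := by have := min_le_left R ρ₀; linarith
  have hρρ : ρ < ρ₀ := by have := min_le_right R ρ₀; linarith
  have hsub : ∀ w, ‖w‖ ≤ ρ → w ∈ ball (0 : ℂ) R := by
    intro w hw; simp; linarith
  have hcF : ∀ w ∈ closedBall (0 : ℂ) ρ, HolAt F (0, w) := fun w hw =>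
    (hRb w (hsub w (by simpa using hw))).2
  have hsF : ∀ w ∈ sphere (0 : ℂ) ρ, F (0, w) ≠ 0 := by
    intro w hw
    have hw' : ‖w‖ = ρ := by simpa using hw
    apply (hRb w (hsub w hw'.le)).1
    intro h
    simp only [mem_singleton_iff] at h
    rw [h] at hw'; simp at hw'; linarith
  have ht1 : ∀ᶠ y in 𝓝 (0 : Y), ∀ w ∈ closedBall (0 : ℂ) ρ, HolAt F (y, w) := by
    apply (isCompact_closedBall (0 : ℂ) ρ).eventually_forall_of_forall_eventually
    intro w hw
    exact (hcF w hw).eventually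
  have ht2 : ∀ᶠ y in 𝓝 (0 : Y), ∀ w ∈ sphere (0 : ℂ) ρ, F (y, w) ≠ 0 := by
    apply (isCompact_sphere (0 : ℂ) ρ).eventually_forall_of_forall_eventually
    intro w hw
    exact (hcF w (sphere_subset_closedBall hw)).diff.continuousAt.eventually_ne (hsF w hw)
  have hfac : ∀ y, ∃ l : List ℂ, (∀ w ∈ closedBall (0 : ℂ) ρ, HolAt F (y, w)) →
      (∀ w ∈ sphere (0 : ℂ) ρ, F (y, w) ≠ 0) → (∀ a ∈ l, a ∈ ball (0 : ℂ) ρ) ∧ ∃ e : ℂ → ℂ,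
      (∀ w ∈ closedBall (0 : ℂ) ρ, AnalyticAt ℂ e w) ∧ (∀ w ∈ closedBall (0 : ℂ) ρ, e w ≠ 0) ∧
      ∀ w, F (y, w) = (l.map (fun a => w - a)).prod * e w := by
    intro y
    by_cases h : (∀ w ∈ closedBall (0 : ℂ) ρ, HolAt F (y, w)) ∧
      (∀ w ∈ sphere (0 : ℂ) ρ, F (y, w) ≠ 0)
    · obtain ⟨l, hl⟩ := factor_disc hρ (f := fun w => F (y, w)) (fun w hw => (h.1 w hw).slice) h.2
      exact ⟨l, fun _ _ => hl⟩
    · exact ⟨[], fun h1 h2 => absurd ⟨h1, h2⟩ h⟩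
  choose l hl using hfac
  -- power sums
  have hsum : ∀ g : Y × ℂ → ℂ, (∀ w, ‖w‖ ≤ ρ → HolAt g (0, w)) →
      HolAt (fun y => ((l y).map (fun a => g (y, a))).sum) 0 := by
    intro g hg
    have hI : HolAt (fun y => (2 * Real.pi * Complex.I : ℂ)⁻¹ *
        ∮ w in C(0, ρ), g (y, w) * (deriv (fun w => F (y, w)) w * (F (y, w))⁻¹)) 0 := by
      apply (holAt_const _ _).mul
      apply holAt_circleIntegral (Φ := fun q : Y × ℂ => g q *
        (deriv (fun w => F (q.1, w)) q.2 * (F q)⁻¹)) hρ.le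
      intro w hw
      have hw' := sphere_subset_closedBall hw
      apply (hg w (by simpa using hw')).mul
      apply (hcF w hw').partial_hol.mul
      filter_upwards [hcF w hw', (hcF w hw').diff.continuousAt.eventually_ne (hsF w hw)] with q h1 h2
      exact h1.inv h2
    refine hI.congr ?_
    have hg1 : ∀ᶠ y in 𝓝 (0 : Y), ∀ w ∈ closedBall (0 : ℂ) ρ, HolAt g (y, w) := by
      apply (isCompact_closedBall (0 : ℂ) ρ).eventually_forall_of_forall_eventually
      intro w hw
      exact (hg w (by simpa using hw)).eventually
    filter_upwards [ht1, ht2, hg1] with y h1 h2 h3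
    obtain ⟨hla, e, he, he0, hle⟩ := hl y h1 h2
    have := sum_roots_integral hρ (g := fun w => g (y, w)) (fun w hw => (h3 w hw).slice) he he0
      (l y) hla
    have hfun : (fun w => F (y, w)) = fun w => ((l y).map (fun a => w - a)).prod * e w :=
      funext hle
    rw [← hfun] at this
    simp only [logDeriv_apply, div_eq_mul_inv] at this
    rw [this, inv_mul_cancel_left₀]
    simp [Real.pi_ne_zero]
  -- constant number of roots
  set p := (l 0).length with hp
  have hlen : ∀ᶠ y in 𝓝 (0 : Y), (l y).length = p := by
    have h1 := (hsum (fun _ => 1) (fun w _ => holAt_const _ _)).diff.continuousAt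
    simp only [List.map_const', List.sum_replicate, nsmul_eq_mul, mul_one] at h1
    have h2 := Metric.tendsto_nhds.1 h1 1 one_pos
    filter_upwards [h2] with y hy
    rw [dist_eq_norm] at hy
    by_contra hcon
    have h3 : (1 : ℝ) ≤ ‖(((l y).length : ℤ) - (p : ℤ) : ℤ)‖ := by
      rw [Int.norm_eq_abs]
      have : (1 : ℤ) ≤ |((l y).length : ℤ) - (p : ℤ)| := Int.one_le_abs (by omega)
      exact_mod_cast this
    have h4 : ‖((l y).length : ℂ) - (p : ℂ)‖ = ‖(((l y).length : ℤ) - (p : ℤ) : ℤ)‖ := by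
      rw [show ((l y).length : ℂ) - (p : ℂ) = ((((l y).length : ℤ) - (p : ℤ) : ℤ) : ℂ) by
        push_cast; rfl, Complex.norm_intCast, Int.norm_eq_abs]
    rw [h4] at hy
    linarith
  have hofn : ∀ y, (l y).length = p → List.ofFn (fun i : Fin p => (l y).getD i 0) = l y := by
    intro y hy
    apply List.ext_getElem
    · simp [hy]
    · intro i h1 h2
      simp [List.getElem?_eq_getElem h2]
  refine ⟨ρ, hρ, hρρ, p, fun y i => (l y).getD i 0, ?_, ?_, ?_⟩
  · filter_upwards [ht1, ht2, hlen] with y h1 h2 h3 i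
    have hi : (i : ℕ) < (l y).length := by rw [h3]; exact i.2
    rw [List.getD_eq_getElem _ _ hi]
    simpa using (hl y h1 h2).1 _ (List.getElem_mem hi)
  · filter_upwards [ht1, ht2, hlen] with y h1 h2 h3 w hw
    obtain ⟨hla, e, he, he0, hle⟩ := hl y h1 h2
    rw [hle w, mul_eq_zero, or_iff_left (he0 w (by simpa using hw.le)), List.prod_eq_zero_iff]
    have hmem : w ∈ l y ↔ ∃ i : Fin p, (l y).getD i 0 = w := by
      conv_lhs => rw [← hofn y h3]
      simp [List.mem_ofFn]
    rw [← hmem, List.mem_map]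
    constructor
    · rintro ⟨a, ha, h⟩
      rwa [sub_eq_zero.1 h]
    · intro h
      exact ⟨w, h, sub_self w⟩
  · intro g hg k
    apply newton_hol
    intro k
    refine (hsum (fun q => g q ^ k) (fun w hw => (hg w hw).pow k)).congr ?_
    filter_upwards [hlen] with y hy
    conv_lhs => rw [← hofn y hy]
    rw [List.map_ofFn, List.sum_ofFn]
    rfl

end roots

section elim
open Filter Topology Set Metric

theorem HolAt.prod_fin {Y : Type*} [NormedAddCommGroup Y] [NormedSpace ℂ Y] {V : Type*}
    [NormedAddCommGroup V] [NormedSpace ℂ V] {W : Type*}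
    [NormedAddCommGroup W] [NormedSpace ℂ W] {f : Y → V} {g : Y → W} {x : Y} (hf : HolAt f x)
    (hg : HolAt g x) : HolAt (fun y => (f y, g y)) x := by
  filter_upwards [hf, hg] with y h1 h2 using h1.prodMk h2

theorem holAt_clm {Y : Type*} [NormedAddCommGroup Y] [NormedSpace ℂ Y] {V : Type*}
    [NormedAddCommGroup V] [NormedSpace ℂ V] (L : Y →L[ℂ] V) (x : Y) : HolAt (fun y => L y) x :=
  holAt_of_differentiable L.differentiable x

theorem elim_one {Y : Type*} [NormedAddCommGroup Y] [NormedSpace ℂ Y] {r : ℕ}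
    (f : Fin r → Y × ℂ → ℂ) (hf : ∀ i, HolAt (f i) (0, 0)) (i0 : Fin r)
    (hi0 : ¬ ∀ᶠ w in 𝓝 (0:ℂ), f i0 (0, w) = 0) (ρ₀ : ℝ) (hρ₀ : 0 < ρ₀) :
    ∃ ρ, 0 < ρ ∧ ρ < ρ₀ ∧ ∃ (s : ℕ) (h : Fin s → Y → ℂ), (∀ j, HolAt (h j) 0) ∧
      ∀ᶠ y in 𝓝 (0:Y), (∀ j, h j y = 0) ↔ ∃ w, ‖w‖ < ρ ∧ ∀ i, f i (y, w) = 0 := by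
  have h1 : ∀ᶠ w in 𝓝 (0:ℂ), ∀ i, HolAt (f i) ((0:Y), w) := by
    rw [eventually_all]
    intro i
    have hc : ContinuousAt (fun w : ℂ => ((0:Y), w)) 0 := by fun_prop
    exact hc.eventually (hf i).eventually
  obtain ⟨R, hR, hRb⟩ := Metric.eventually_nhds_iff_ball.1 h1
  obtain ⟨ρ, hρ, hρlt, p, ζ, hζ1, hζ2, hζ3⟩ :=
    roots_lemma (f i0) (hf i0) hi0 (min ρ₀ R) (lt_min hρ₀ hR)
  refine ⟨ρ, hρ, hρlt.trans_le (min_le_left _ _), p * r + 1,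
    fun s y => ∏ i, ∑ k : Fin r, (s : ℂ) ^ (k : ℕ) * f k (y, ζ y i), ?_, ?_⟩
  · intro s
    have h2 := hζ3 (fun x => ∑ k : Fin r, (s : ℂ) ^ (k : ℕ) * f k x) ?_ p
    · refine h2.congr (Eventually.of_forall fun y => ?_)
      simp only [MvPolynomial.esymm, map_sum, map_prod, MvPolynomial.aeval_X]
      have : Finset.powersetCard p (Finset.univ : Finset (Fin p)) = {Finset.univ} := by
        have h5 := Finset.powersetCard_self (Finset.univ : Finset (Fin p))
        rwa [show (Finset.univ : Finset (Fin p)).card = p from Finset.card_fin p] at h5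
      rw [this]; simp
    · intro w hw
      apply HolAt.sum
      intro k _
      exact (holAt_const _ _).mul (hRb w (by
        simpa using hw.trans_lt (hρlt.trans_le (min_le_right _ _))) k)
  · filter_upwards [hζ1, hζ2] with y hy1 hy2
    constructor
    · intro hs
      by_contra hcon
      push Not at hcon
      have hq : ∀ i, (∑ k : Fin r, Polynomial.C (f k (y, ζ y i)) * Polynomial.X ^ (k : ℕ)) ≠ 0 := by
        intro i hi
        obtain ⟨k, hk⟩ := hcon (ζ y i) (hy1 i)
        apply hk
        have := congrArg (fun q => Polynomial.coeff q (k : ℕ)) hi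
        simpa [Polynomial.finsetSum_coeff, Polynomial.coeff_C_mul, Polynomial.coeff_X_pow,
          Fin.val_inj] using this
      have hprod : (∏ i, ∑ k : Fin r, Polynomial.C (f k (y, ζ y i)) * Polynomial.X ^ (k : ℕ)) ≠ 0 :=
        Finset.prod_ne_zero_iff.2 fun i _ => hq i
      apply hprod
      have hinj : Function.Injective (fun s : Fin (p * r + 1) => ((s : ℕ) : ℂ)) := by
        intro a b hab
        have hab' : ((a : ℕ) : ℂ) = ((b : ℕ) : ℂ) := hab
        exact Fin.ext (by exact_mod_cast hab')
      apply Polynomial.eq_zero_of_natDegree_lt_card_of_eval_eq_zero _ hinj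
      · intro s
        rw [Polynomial.eval_prod]
        have := hs s
        simp only [Polynomial.eval_finsetSum, Polynomial.eval_mul, Polynomial.eval_C,
          Polynomial.eval_pow, Polynomial.eval_X]
        simp only [mul_comm] at this ⊢
        exact this
      · rw [Fintype.card_fin]
        apply Nat.lt_succ_of_le
        refine (Polynomial.natDegree_prod_le _ _).trans ?_
        calc _ ≤ ∑ i : Fin p, r := by
              apply Finset.sum_le_sum
              intro i _
              apply Polynomial.natDegree_sum_le_of_forall_le
              intro k _
              exact (Polynomial.natDegree_C_mul_X_pow_le _ _).trans k.2.le
          _ = p * r := by simp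
    · rintro ⟨w, hw, hfw⟩ j
      obtain ⟨i, hi⟩ := (hy2 w hw).1 (hfw i0)
      apply Finset.prod_eq_zero (Finset.mem_univ i)
      apply Finset.sum_eq_zero
      intro k _
      rw [hi, hfw k, mul_zero]

/-- elimination of the `V` variables -/
theorem elim_all (d : ℕ) : ∀ (V : Type) [NormedAddCommGroup V] [NormedSpace ℂ V]
    [FiniteDimensional ℂ V] (_ : Module.finrank ℂ V = d)
    (Y : Type) [NormedAddCommGroup Y] [NormedSpace ℂ Y] (r : ℕ) (f : Fin r → Y × V → ℂ)
    (_ : ∀ i, HolAt (f i) (0, 0)) (_ : ∀ᶠ v in 𝓝 (0:V), (∀ i, f i (0, v) = 0) → v = 0)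
    (O : Set V) (_ : O ∈ 𝓝 (0:V)),
    ∃ U ∈ 𝓝 (0:V), U ⊆ O ∧ ∃ (s : ℕ) (h : Fin s → Y → ℂ), (∀ j, HolAt (h j) 0) ∧
      ∀ᶠ y in 𝓝 (0:Y), (∀ j, h j y = 0) ↔ ∃ v ∈ U, ∀ i, f i (y, v) = 0 := by
  induction d with
  | zero =>
    intro V _ _ _ hV Y _ _ r f hf hiso O hO
    have hsub : Subsingleton V := Module.finrank_zero_iff.1 hV
    refine ⟨O, hO, le_rfl, r, fun i y => f i (y, 0), fun i => ?_, Eventually.of_forall fun y => ?_⟩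
    · exact HolAt.comp (g := f i) (hf i) ((holAt_clm (ContinuousLinearMap.id ℂ Y) 0).prod_fin (holAt_const 0 _))
    · constructor
      · intro h
        exact ⟨0, mem_of_mem_nhds hO, h⟩
      · rintro ⟨v, _, h⟩
        rwa [Subsingleton.elim v 0] at h
  | succ d ih =>
    intro V _ _ _ hV Y _ _ r f hf hiso O hO
    have hnt : Nontrivial V := Module.nontrivial_of_finrank_pos (R := ℂ) (by omega)
    obtain ⟨R, hR, hRb⟩ := Metric.eventually_nhds_iff_ball.1 hiso
    -- a direction and an index
    have hdir : ∃ v₀ : V, v₀ ≠ 0 ∧ ∃ i0, ¬ ∀ᶠ w in 𝓝 (0:ℂ), f i0 (0, w • v₀) = 0 := by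
      obtain ⟨v₀, hv₀⟩ := exists_ne (0 : V)
      refine ⟨v₀, hv₀, ?_⟩
      by_contra hcon
      push Not at hcon
      have h1 : ∀ᶠ w in 𝓝 (0:ℂ), ∀ i, f i (0, w • v₀) = 0 := eventually_all.2 hcon
      have h2 : ∀ᶠ w in 𝓝 (0:ℂ), w • v₀ = 0 := by
        have hc : ContinuousAt (fun w : ℂ => w • v₀) 0 := by fun_prop
        have := hc.eventually (by simpa using hiso)
        filter_upwards [h1, this] with w hw1 hw2 using hw2 hw1
      have h3 : ∀ᶠ w in 𝓝[≠] (0:ℂ), w • v₀ = 0 := h2.filter_mono nhdsWithin_le_nhds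
      obtain ⟨w, hw, hw0⟩ := (h3.and self_mem_nhdsWithin).exists
      simp [hv₀] at hw
      exact hw0 hw
    obtain ⟨v₀, hv₀, i0, hi0⟩ := hdir
    obtain ⟨V', hV'⟩ := Submodule.exists_isCompl (ℂ ∙ v₀)
    have hfr : Module.finrank ℂ V' = d := by
      have h1 := Submodule.finrank_add_eq_of_isCompl hV'
      rw [finrank_span_singleton hv₀] at h1
      omega
    -- the equivalence
    let eL : (V' × ℂ) →ₗ[ℂ] V := (V'.subtype).coprod (LinearMap.toSpanSingleton ℂ V v₀)
    have hinj : Function.Injective eL := by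
      rw [injective_iff_map_eq_zero]
      rintro ⟨a, w⟩ haw
      have haw' : (a : V) + w • v₀ = 0 := by simpa [eL] using haw
      have hm : (a : V) ∈ (ℂ ∙ v₀) := by
        rw [eq_neg_of_add_eq_zero_left haw']
        exact Submodule.neg_mem _ (Submodule.smul_mem _ _ (Submodule.mem_span_singleton_self _))
      have ha : (a : V) = 0 := by
        have := hV'.disjoint.le_bot ⟨hm, a.2⟩
        simpa using this
      have hw : w = 0 := by
        rw [ha, zero_add] at haw'
        simpa [hv₀] using haw'
      simp [hw, Submodule.coe_eq_zero.1 ha]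
    let e : (V' × ℂ) ≃L[ℂ] V := (LinearEquiv.ofInjectiveOfFinrankEq eL hinj (by
      rw [Module.finrank_prod, hfr, hV]; simp)).toContinuousLinearEquiv
    have he : ∀ x, e x = (x.1 : V) + x.2 • v₀ := by
      intro x
      simp [e, eL, LinearEquiv.ofInjectiveOfFinrankEq]
    let f' : Fin r → (Y × V') × ℂ → ℂ := fun i x => f i (x.1.1, e (x.1.2, x.2))
    have hf' : ∀ i, HolAt (f' i) (0, 0) := by
      intro i
      refine HolAt.comp (g := f i) (f := fun x : (Y × V') × ℂ => (x.1.1, e (x.1.2, x.2))) ?_ ?_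
      · have h00 : e ((0:V'), (0:ℂ)) = 0 := by rw [he]; simp
        simpa [h00] using hf i
      · refine holAt_of_differentiable ?_ _
        have : Differentiable ℂ e := e.differentiable
        fun_prop
    have hOc : e ⁻¹' O ∈ 𝓝 ((0:V'), (0:ℂ)) := by
      have : ContinuousAt e 0 := e.continuous.continuousAt
      exact this (by simpa using hO)
    rw [nhds_prod_eq] at hOc
    obtain ⟨O1, hO1, O2, hO2, hO12⟩ := Filter.mem_prod_iff.1 hOc
    obtain ⟨ρ₀, hρ₀, hρ₀b⟩ := Metric.mem_nhds_iff.1 hO2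
    -- isolation radius
    have hiso' : ∀ᶠ x in 𝓝 ((0:V'), (0:ℂ)), (∀ i, f i (0, e x) = 0) → e x = 0 := by
      have : ContinuousAt e 0 := e.continuous.continuousAt
      exact this.eventually (by simpa using hiso)
    rw [nhds_prod_eq] at hiso'
    obtain ⟨I1, hI1, I2, hI2, hI12⟩ := Filter.mem_prod_iff.1 hiso'
    obtain ⟨ρ₁, hρ₁, hρ₁b⟩ := Metric.mem_nhds_iff.1 hI2
    obtain ⟨ρ, hρ, hρlt, s, h, hh, hhe⟩ := elim_one f' hf' i0 (by
      simpa [f', he] using hi0) (min ρ₀ ρ₁) (lt_min hρ₀ hρ₁)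
    have hh2 : ∀ᶠ v in 𝓝 (0:V'), (∀ j, h j (0, v) = 0) → v = 0 := by
      have hc : ContinuousAt (fun v : V' => ((0:Y), v)) 0 := by fun_prop
      filter_upwards [hc.eventually hhe, hI1] with v hv hvI hvj
      obtain ⟨w, hw, hfw⟩ := hv.1 hvj
      have h3 := hI12 (Set.mk_mem_prod hvI (hρ₁b (show w ∈ ball 0 ρ₁ by
        simpa using hw.trans (hρlt.trans_le (min_le_right _ _)))))
      have h4 := h3 hfw
      have h5 : (v, w) = 0 := by simpa using h4
      exact (Prod.ext_iff.1 h5).1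
    have hhe' : {x : Y × V' | (∀ j, h j x = 0) ↔ ∃ w, ‖w‖ < ρ ∧ ∀ i, f' i (x, w) = 0} ∈
      𝓝 (0:Y) ×ˢ 𝓝 (0:V') := by rw [← nhds_prod_eq]; exact hhe
    obtain ⟨A1, hA1, A2, hA2, hA12⟩ := Filter.mem_prod_iff.1 hhe'
    obtain ⟨U', hU', hU'O, s', h', hh', hhe''⟩ := ih V' hfr Y s h hh hh2 (A2 ∩ O1)
      (inter_mem hA2 hO1)
    refine ⟨e '' (U' ×ˢ ball 0 ρ), ?_, ?_, s', h', hh', ?_⟩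
    · have : (U' ×ˢ ball (0:ℂ) ρ) ∈ 𝓝 (0 : V' × ℂ) :=
        prod_mem_nhds hU' (ball_mem_nhds _ hρ)
      have h7 := e.toHomeomorph.isOpenMap.image_mem_nhds this
      simpa using h7
    · rintro _ ⟨⟨a, w⟩, ⟨ha, hw⟩, rfl⟩
      exact hO12 (Set.mk_mem_prod (hU'O ha).2 (hρ₀b (ball_subset_ball
        (hρlt.le.trans (min_le_left _ _)) hw)))
    · filter_upwards [hhe'', hA1] with y hy hyA
      rw [hy]
      constructor
      · rintro ⟨v, hv, hvj⟩
        have := hA12 (Set.mk_mem_prod hyA (hU'O hv).1)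
        obtain ⟨w, hw, hfw⟩ := this.1 hvj
        exact ⟨e (v, w), ⟨(v, w), ⟨hv, by simpa using hw⟩, rfl⟩, hfw⟩
      · rintro ⟨_, ⟨⟨v, w⟩, ⟨hv, hw⟩, rfl⟩, hfw⟩
        have := hA12 (Set.mk_mem_prod hyA (hU'O hv).1)
        exact ⟨v, hv, this.2 ⟨w, by simpa using hw, hfw⟩⟩

end elim

section integral
open Filter Topology Set Metric

theorem integral_eq {V : Type} [NormedAddCommGroup V] [NormedSpace ℂ V] [FiniteDimensional ℂ V]
    {n r : ℕ} (f : Fin r → V → ℂ) (hf : ∀ i, HolAt (f i) 0) (P : V →L[ℂ] (Fin n → ℂ))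
    (l : V →L[ℂ] ℂ) (hiso : ∀ᶠ z in 𝓝 (0:V), (∀ i, f i z = 0) → P z = 0 → z = 0) :
    ∃ (p : ℕ) (A : (Fin n → ℂ) → Polynomial ℂ), (∀ y, (A y).Monic) ∧ (∀ y, (A y).natDegree = p) ∧
      (∀ k, HolAt (fun y => (A y).coeff k) 0) ∧
      ∀ᶠ z in 𝓝 (0:V), (∀ i, f i z = 0) → (A (P z)).eval (l z) = 0 := by
  let ι := Fin r ⊕ (Fin n ⊕ Unit)
  let e : Fin (Fintype.card ι) ≃ ι := (Fintype.equivFin ι).symm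
  let g : ι → ((Fin n → ℂ) × ℂ) × V → ℂ := fun i x =>
    Sum.elim (fun i => f i x.2) (Sum.elim (fun j => P x.2 j - x.1.1 j) (fun _ => l x.2 - x.1.2)) i
  have hzero : ∀ x, (∀ i, g (e i) x = 0) ↔ ((∀ i, f i x.2 = 0) ∧ P x.2 = x.1.1 ∧ l x.2 = x.1.2) := by
    intro x
    constructor
    · intro h
      have h' : ∀ i, g i x = 0 := fun i => by simpa using h (e.symm i)
      refine ⟨fun i => h' (Sum.inl i), ?_, ?_⟩
      · ext j
        exact sub_eq_zero.1 (h' (Sum.inr (Sum.inl j)))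
      · exact sub_eq_zero.1 (h' (Sum.inr (Sum.inr ())))
    · rintro ⟨h1, h2, h3⟩ i
      rcases e i with i | j | u
      · exact h1 i
      · simp [g, h2]
      · simp [g, h3]
  have hg : ∀ i, HolAt (g i) 0 := by
    rintro (i | j | u)
    · exact HolAt.comp (g := f i) (hf i) (holAt_of_differentiable differentiable_snd _)
    · refine holAt_of_differentiable ?_ _
      have h1 : Differentiable ℂ P := P.differentiable
      simp only [g, Sum.elim_inr, Sum.elim_inl]
      fun_prop
    · refine holAt_of_differentiable ?_ _
      have h1 : Differentiable ℂ l := l.differentiable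
      simp only [g, Sum.elim_inr]
      fun_prop
  obtain ⟨U, hU, hUO, s, h, hh, hhe⟩ := elim_all _ V rfl ((Fin n → ℂ) × ℂ) _ (fun i => g (e i))
    (fun i => hg _) (by
      filter_upwards [hiso] with v hv h0
      have := (hzero (0, v)).1 h0
      exact hv this.1 this.2.1) _ hiso
  have hj : ∃ j, ¬ ∀ᶠ w in 𝓝 (0:ℂ), h j (0, w) = 0 := by
    by_contra hcon
    push Not at hcon
    have h1 : ∀ᶠ w in 𝓝 (0:ℂ), ∀ j, h j (0, w) = 0 := eventually_all.2 hcon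
    have hc : ContinuousAt (fun w : ℂ => ((0:Fin n → ℂ), w)) 0 := by fun_prop
    have h2 : ∀ᶠ w in 𝓝 (0:ℂ), w = 0 := by
      filter_upwards [h1, hc.eventually hhe] with w hw1 hw2
      obtain ⟨v, hv, hv2⟩ := hw2.1 hw1
      have h3 := (hzero ((0, w), v)).1 hv2
      have h4 : v = 0 := hUO hv h3.1 h3.2.1
      have h5 := h3.2.2
      simp [h4] at h5
      exact h5.symm
    have h3 : ∀ᶠ w in 𝓝[≠] (0:ℂ), w = 0 := h2.filter_mono nhdsWithin_le_nhds
    obtain ⟨w, hw, hw0⟩ := (h3.and self_mem_nhdsWithin).exists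
    exact hw0 hw
  obtain ⟨j, hj⟩ := hj
  obtain ⟨ρ, hρ, -, p, ζ, hζ1, hζ2, hζ3⟩ := roots_lemma (h j) (hh j) hj 1 one_pos
  refine ⟨p, fun y => ((Finset.univ.val.map (ζ y)).map fun r => Polynomial.X - Polynomial.C r).prod,
    ?_, ?_, ?_, ?_⟩
  · intro y
    exact Polynomial.monic_multisetProd_X_sub_C _
  · intro y
    rw [Polynomial.natDegree_multiset_prod_X_sub_C_eq_card]
    simp
  · intro k
    by_cases hk : k ≤ p
    · have h1 := hζ3 (fun x => x.2) (fun w _ => holAt_of_differentiable differentiable_snd _) (p - k)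
      refine ((holAt_const ((-1) ^ (p - k)) _).mul h1).congr (Eventually.of_forall fun y => ?_)
      simp only
      rw [Multiset.prod_X_sub_C_coeff _ (by simpa using hk), MvPolynomial.aeval_esymm_eq_multiset_esymm]
      simp
    · refine (holAt_const 0 _).congr (Eventually.of_forall fun y => ?_)
      symm
      apply Polynomial.coeff_eq_zero_of_natDegree_lt
      rw [Polynomial.natDegree_multiset_prod_X_sub_C_eq_card]
      simpa using hk
  · have hc : ContinuousAt (fun z : V => (P z, l z)) 0 :=
      (P.continuous.prodMk l.continuous).continuousAt
    have hc1 : ContinuousAt P 0 := P.continuous.continuousAt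
    have hc2 : ContinuousAt l 0 := l.continuous.continuousAt
    have h1 := hc.eventually (p := fun y => (∀ j, h j y = 0) ↔ ∃ v ∈ U, ∀ i, g (e i) (y, v) = 0) (by
      simp only [map_zero]; exact hhe)
    have h2 := hc1.eventually (p := fun y => ∀ w, ‖w‖ < ρ → (h j (y, w) = 0 ↔ ∃ i, ζ y i = w)) (by
      simpa using hζ2)
    have h3 := hc2.eventually (p := fun w => ‖w‖ < ρ) (by
      have := ball_mem_nhds (0:ℂ) hρ
      filter_upwards [by simpa using this] with w hw
      simpa using hw)
    filter_upwards [h1, h2, h3, hU] with z hz1 hz2 hz3 hzU hfz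
    have h4 := hz1.2 ⟨z, hzU, (hzero ((P z, l z), z)).2 ⟨hfz, rfl, rfl⟩⟩ j
    obtain ⟨i, hi⟩ := (hz2 _ hz3).1 h4
    rw [Polynomial.eval_multiset_prod, Multiset.prod_eq_zero_iff]
    simp only [Multiset.map_map, Multiset.mem_map]
    exact ⟨i, Finset.mem_univ_val i, by simp [hi]⟩

end integral

section meas
open Filter Topology Set Metric
open scoped ENNReal NNReal

theorem measure_fibre_bound {E Y : Type*} [MetricSpace E] [SecondCountableTopology E]
    [CompleteSpace E] [MeasurableSpace E] [BorelSpace E]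
    [MetricSpace Y] [SecondCountableTopology Y] [MeasurableSpace Y] [BorelSpace Y]
    {S : Set E} (hS : MeasurableSet S) {P : E → Y} (hP : Continuous P) (K : ℝ≥0) (d : ℕ)
    (hloc : ∀ z ∈ S, ∃ V ∈ 𝓝 z, ∀ a ∈ S ∩ V, ∀ b ∈ S ∩ V, edist a b ≤ K * edist (P a) (P b))
    (hfib : ∀ y, (S ∩ P ⁻¹' {y}).encard ≤ d) {B : Set Y} (hB : MapsTo P S B)
    (m : ℝ) (hm : 0 ≤ m) :
    μH[m] S ≤ (K : ℝ≥0∞) ^ m * (d * μH[m] B) := by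
  rcases S.eq_empty_or_nonempty with rfl | hSne
  · simp
  choose! V hV hVK using hloc
  obtain ⟨t, htS, htc, htcov⟩ := TopologicalSpace.countable_cover_nhdsWithin
    (f := fun z => interior (V z)) (s := S) (fun z hz => mem_nhdsWithin_of_mem_nhds
      (interior_mem_nhds.2 (hV z hz)))
  have htne : t.Nonempty := by
    obtain ⟨z, hz⟩ := hSne
    obtain ⟨i, hi, -⟩ := mem_iUnion₂.1 (htcov hz)
    exact ⟨i, hi⟩
  obtain ⟨q, hq⟩ := htc.exists_eq_range htne
  let A : ℕ → Set E := fun i => S ∩ disjointed (fun i => interior (V (q i))) i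
  have hAmeas : ∀ i, MeasurableSet (A i) := fun i =>
    hS.inter (MeasurableSet.disjointed (fun j => isOpen_interior.measurableSet) i)
  have hAdisj : Pairwise (Function.onFun Disjoint A) := by
    intro i j hij
    exact ((disjoint_disjointed _) hij).mono inter_subset_right inter_subset_right
  have hAU : S = ⋃ i, A i := by
    rw [← inter_iUnion, iUnion_disjointed, eq_comm, inter_eq_left]
    intro z hz
    obtain ⟨i, hi, hzi⟩ := mem_iUnion₂.1 (htcov hz)
    rw [hq] at hi
    obtain ⟨j, rfl⟩ := hi
    exact mem_iUnion.2 ⟨j, hzi⟩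
  have hAK : ∀ i, ∀ a ∈ A i, ∀ b ∈ A i, edist a b ≤ K * edist (P a) (P b) := by
    intro i a ha b hb
    have hqi : q i ∈ S := htS (hq ▸ mem_range_self i)
    exact hVK _ hqi a ⟨ha.1, interior_subset (disjointed_subset _ i ha.2)⟩ b
      ⟨hb.1, interior_subset (disjointed_subset _ i hb.2)⟩
  have hAinj : ∀ i, InjOn P (A i) := by
    intro i a ha b hb hab
    have := hAK i a ha b hb
    rw [hab] at this
    simpa using this
  have hPA : ∀ i, MeasurableSet (P '' A i) := fun i =>
    (hAmeas i).image_of_continuousOn_injOn hP.continuousOn (hAinj i)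
  have hstep : ∀ i, μH[m] (A i) ≤ (K : ℝ≥0∞) ^ m * μH[m] (P '' A i) := by
    intro i
    have hanti : AntilipschitzWith K (fun x : A i => P x) := fun a b => hAK i a a.2 b b.2
    have h1 := hanti.le_hausdorffMeasure_image hm univ
    have h2 := (isometry_subtype_coe (s := A i)).hausdorffMeasure_image (Or.inl hm) univ
    rw [← h2] at h1
    simp only [image_univ, Subtype.range_coe] at h1
    have h3 : range (fun x : A i => P x) = P '' A i := by
      ext y; simp
    rwa [h3] at h1
  calc μH[m] S = ∑' i, μH[m] (A i) := by
        conv_lhs => rw [hAU]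
        exact measure_iUnion hAdisj hAmeas
    _ ≤ ∑' i, (K : ℝ≥0∞) ^ m * μH[m] (P '' A i) := ENNReal.tsum_le_tsum hstep
    _ = (K : ℝ≥0∞) ^ m * ∑' i, μH[m] (P '' A i) := ENNReal.tsum_mul_left
    _ ≤ (K : ℝ≥0∞) ^ m * (d * μH[m] B) := by
        gcongr
        have h1 : ∀ i, μH[m] (P '' A i) = ∫⁻ y, (P '' A i).indicator 1 y ∂μH[m] := fun i =>
          (lintegral_indicator_one (hPA i)).symm
        simp_rw [h1]
        rw [← lintegral_tsum (fun i => (measurable_one.indicator (hPA i)).aemeasurable)]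
        calc _ ≤ ∫⁻ y, (toMeasurable μH[m] B).indicator (fun _ => (d : ℝ≥0∞)) y ∂μH[m] := by
              apply lintegral_mono
              intro y
              by_cases hy : y ∈ B
              · rw [indicator_of_mem (subset_toMeasurable _ _ hy)]
                refine ENNReal.summable.tsum_le_of_sum_le fun s => ?_
                classical
                have h2 : (∑ i ∈ s, (P '' A i).indicator (1 : Y → ℝ≥0∞) y) =
                    ((s.filter fun i => y ∈ P '' A i).card : ℝ≥0∞) := by
                  simp [indicator_apply]
                rw [h2]
                have h3 : (s.filter fun i => y ∈ P '' A i).card ≤ d := by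
                  have hch : ∀ i : ℕ, ∃ z, y ∈ P '' A i → (z ∈ A i ∧ P z = y) := by
                    intro i
                    by_cases hi : y ∈ P '' A i
                    · obtain ⟨z, hz⟩ := hi
                      exact ⟨z, fun _ => hz⟩
                    · exact ⟨hSne.some, fun h => absurd h hi⟩
                  choose w hw using hch
                  have h4 : ((s.filter fun i => y ∈ P '' A i).card : ℕ∞) ≤
                      (S ∩ P ⁻¹' {y}).encard := by
                    rw [← Set.encard_coe_eq_coe_finsetCard]
                    refine Set.encard_le_encard_of_injOn (f := w) ?_ ?_
                    · intro i hi
                      have hi' : y ∈ P '' A i := by simpa using (Finset.mem_filter.1 hi).2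
                      exact ⟨(hw i hi').1.1, (hw i hi').2⟩
                    · intro i hi j hj hij
                      have hi' : y ∈ P '' A i := by simpa using (Finset.mem_filter.1 hi).2
                      have hj' : y ∈ P '' A j := by simpa using (Finset.mem_filter.1 hj).2
                      by_contra hne
                      have hd := Set.disjoint_left.1 (hAdisj hne) (hw i hi').1
                      rw [hij] at hd
                      exact hd (hw j hj').1
                  exact_mod_cast h4.trans (hfib y)
                exact_mod_cast h3
              · have h0 : ∀ i, (P '' A i).indicator (1 : Y → ℝ≥0∞) y = 0 := by
                  intro i
                  apply indicator_of_notMem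
                  rintro ⟨z, hz, rfl⟩
                  exact hy (hB hz.1)
                simp [h0]
          _ = d * μH[m] B := by
              rw [lintegral_indicator_const (measurableSet_toMeasurable _ _), measure_toMeasurable]

end meas

section family
open Filter Topology Set Metric
open scoped NNReal

theorem family_step {n N : ℕ} (p₀ : (Fin N → ℂ) →L[ℂ] (Fin n → ℂ)) (δ : ℝ) (hδ : 0 < δ)
    (L : EuclideanSpace ℂ (Fin n) →L[ℂ] (Fin N → ℂ)) (hL : Function.Injective L) :
    ∃ P : (Fin N → ℂ) →L[ℂ] (Fin n → ℂ), ‖P - p₀‖ < δ ∧ ∃ c : ℝ, 0 < c ∧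
      ∀ x, c * ‖x‖ ≤ ‖P (L x)‖ := by
  let φ : EuclideanSpace ℂ (Fin n) ≃L[ℂ] (Fin n → ℂ) := PiLp.continuousLinearEquiv 2 ℂ _
  obtain ⟨M, hM⟩ := LinearMap.exists_leftInverse_of_injective (L : EuclideanSpace ℂ (Fin n) →ₗ[ℂ] (Fin N → ℂ))
    (LinearMap.ker_eq_bot.2 hL)
  have hM' : ∀ x, M (L x) = x := fun x => by
    have := congrArg (fun g => g x) hM
    simpa using this
  let Mc : (Fin N → ℂ) →L[ℂ] (Fin n → ℂ) := (φ : EuclideanSpace ℂ (Fin n) →L[ℂ] (Fin n → ℂ)).comp (LinearMap.toContinuousLinearMap M)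
  let B : Module.End ℂ (EuclideanSpace ℂ (Fin n)) :=
    ((φ.symm : (Fin n → ℂ) →L[ℂ] EuclideanSpace ℂ (Fin n)).comp (p₀.comp L) : EuclideanSpace ℂ (Fin n) →L[ℂ] EuclideanSpace ℂ (Fin n))
  have hfin := Module.End.finite_hasEigenvalue B
  have hinf : (ball (0:ℂ) (δ / (‖Mc‖ + 1))).Infinite :=
    infinite_of_mem_nhds 0 (ball_mem_nhds _ (by positivity))
  obtain ⟨s, hs, hsB⟩ := hinf.exists_notMem_finite hfin
  refine ⟨p₀ - s • Mc, ?_, ?_⟩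
  · have h1 : p₀ - s • Mc - p₀ = -(s • Mc) := by abel
    rw [h1, norm_neg, norm_smul]
    have h2 : ‖s‖ < δ / (‖Mc‖ + 1) := by simpa using hs
    rw [lt_div_iff₀ (by positivity)] at h2
    nlinarith [norm_nonneg s]
  · have hinj : Function.Injective (((p₀ - s • Mc).comp L : EuclideanSpace ℂ (Fin n) →L[ℂ] (Fin n → ℂ)) : EuclideanSpace ℂ (Fin n) →ₗ[ℂ] (Fin n → ℂ)) := by
      rw [injective_iff_map_eq_zero]
      intro x hx
      by_contra hx0
      apply hsB
      apply Module.End.hasEigenvalue_of_hasEigenvector (x := x)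
      rw [Module.End.hasEigenvector_iff]
      refine ⟨?_, hx0⟩
      rw [Module.End.mem_eigenspace_iff]
      have h1 : p₀ (L x) - s • φ x = 0 := by
        simpa [Mc, hM'] using hx
      have h2 : B x = φ.symm (p₀ (L x)) := rfl
      rw [h2, sub_eq_zero.1 h1]
      simp
    obtain ⟨K, hK, hK2⟩ := LinearMap.exists_antilipschitzWith _ (LinearMap.ker_eq_bot.2 hinj)
    refine ⟨(K:ℝ)⁻¹, by positivity, fun x => ?_⟩
    have h3 := hK2.le_mul_dist x 0
    rw [map_zero, dist_zero_right, dist_zero_right] at h3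
    rw [inv_mul_le_iff₀ (by positivity)]
    exact h3

theorem finite_family {n N : ℕ} (p₀ : (Fin N → ℂ) →L[ℂ] (Fin n → ℂ))
    (hsurj : Function.Surjective p₀) (δ : ℝ) (hδ : 0 < δ) :
    ∃ (F : Finset ((Fin N → ℂ) →L[ℂ] (Fin n → ℂ))) (c : ℝ), 0 < c ∧ (∀ P ∈ F, ‖P - p₀‖ < δ) ∧
      ∀ T : Submodule ℂ (Fin N → ℂ), (∀ v ∈ T, p₀ v = 0 → v = 0) →
        ∃ P ∈ F, ∀ v ∈ T, c * ‖v‖ ≤ ‖P v‖ := by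
  classical
  let ψ : EuclideanSpace ℂ (Fin N) ≃L[ℂ] (Fin N → ℂ) := PiLp.continuousLinearEquiv 2 ℂ _
  let ψc : EuclideanSpace ℂ (Fin N) →L[ℂ] (Fin N → ℂ) := ψ
  let 𝓚 : Set (EuclideanSpace ℂ (Fin n) →L[ℂ] EuclideanSpace ℂ (Fin N)) :=
    {L | ∀ x, ‖L x‖ = ‖x‖}
  have hcomp : IsCompact 𝓚 := by
    apply Metric.isCompact_of_isClosed_isBounded
    · have : 𝓚 = ⋂ x, {L | ‖L x‖ = ‖x‖} := by ext; simp [𝓚]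
      rw [this]
      apply isClosed_iInter
      intro x
      apply isClosed_eq _ continuous_const
      exact ((ContinuousLinearMap.apply ℂ _ x).continuous).norm
    · refine (isBounded_closedBall (x := 0) (r := 1)).subset ?_
      intro L hL
      rw [mem_closedBall, dist_zero_right]
      exact ContinuousLinearMap.opNorm_le_bound _ zero_le_one fun x => by rw [hL x, one_mul]
  have key : ∃ (F : Finset ((Fin N → ℂ) →L[ℂ] (Fin n → ℂ))) (c : ℝ), 0 < c ∧ (∀ P ∈ F, ‖P - p₀‖ < δ) ∧
      ∀ L ∈ 𝓚, ∃ P ∈ F, ∀ x, c * ‖x‖ ≤ ‖P (ψ (L x))‖ := by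
    refine hcomp.induction_on (p := fun s => ∃ (F : Finset ((Fin N → ℂ) →L[ℂ] (Fin n → ℂ))) (c : ℝ),
      0 < c ∧ (∀ P ∈ F, ‖P - p₀‖ < δ) ∧ ∀ L ∈ s, ∃ P ∈ F, ∀ x, c * ‖x‖ ≤ ‖P (ψ (L x))‖) ?_ ?_ ?_ ?_
    · exact ⟨∅, 1, one_pos, by simp, by simp⟩
    · rintro s t hst ⟨F, c, hc, h1, h2⟩
      exact ⟨F, c, hc, h1, fun L hL => h2 L (hst hL)⟩
    · rintro s t ⟨F, c, hc, h1, h2⟩ ⟨F', c', hc', h1', h2'⟩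
      refine ⟨F ∪ F', min c c', lt_min hc hc', ?_, ?_⟩
      · intro P hP
        rcases Finset.mem_union.1 hP with h | h
        · exact h1 P h
        · exact h1' P h
      · rintro L (hL | hL)
        · obtain ⟨P, hP, hP2⟩ := h2 L hL
          exact ⟨P, Finset.mem_union_left _ hP, fun x => le_trans (by gcongr; exact min_le_left _ _) (hP2 x)⟩
        · obtain ⟨P, hP, hP2⟩ := h2' L hL
          exact ⟨P, Finset.mem_union_right _ hP, fun x => le_trans (by gcongr; exact min_le_right _ _) (hP2 x)⟩
    · intro L hL
      have hinj : Function.Injective (ψc.comp L) := by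
        refine ψ.injective.comp ?_
        refine (injective_iff_map_eq_zero L).2 fun x hx => ?_
        have := hL x
        rw [hx, norm_zero] at this
        exact norm_eq_zero.1 this.symm
      obtain ⟨P, hP, c, hc, hPc⟩ := family_step p₀ δ hδ (ψc.comp L) hinj
      set Q : EuclideanSpace ℂ (Fin N) →L[ℂ] (Fin n → ℂ) := P.comp ψc with hQ
      refine ⟨ball L (c / 2 / (‖Q‖ + 1)), mem_nhdsWithin_of_mem_nhds (ball_mem_nhds _ (by positivity)),
        {P}, c / 2, by positivity, by simpa using hP, ?_⟩
      intro L' hL'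
      refine ⟨P, by simp, fun x => ?_⟩
      have h1 : c * ‖x‖ ≤ ‖Q (L x)‖ := hPc x
      have h2 : ‖L - L'‖ < c / 2 / (‖Q‖ + 1) := by
        rw [norm_sub_rev, ← dist_eq_norm]; exact hL'
      rw [lt_div_iff₀ (by positivity)] at h2
      have h3 : ‖Q (L x) - Q (L' x)‖ ≤ ‖Q‖ * (‖L - L'‖ * ‖x‖) := by
        rw [← map_sub, ← sub_apply]
        exact (Q.le_opNorm _).trans (by gcongr; exact (L - L').le_opNorm x)
      have h4 : ‖Q (L x)‖ ≤ ‖Q (L x) - Q (L' x)‖ + ‖Q (L' x)‖ := by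
        have := norm_add_le (Q (L x) - Q (L' x)) (Q (L' x))
        simpa using this
      have h5 : ‖Q‖ * (‖L - L'‖ * ‖x‖) ≤ c / 2 * ‖x‖ := by
        rw [← mul_assoc]
        gcongr
        nlinarith [norm_nonneg (L - L')]
      change c / 2 * ‖x‖ ≤ ‖Q (L' x)‖
      linarith
  obtain ⟨F, c, hc, h1, h2⟩ := key
  refine ⟨F, c / (‖ψc‖ + 1), by positivity, h1, ?_⟩
  intro T hT
  have hdis : Disjoint T (LinearMap.ker (p₀ : (Fin N → ℂ) →ₗ[ℂ] (Fin n → ℂ))) := by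
    rw [Submodule.disjoint_def]
    intro v hv hv2
    exact hT v hv (by simpa using hv2)
  obtain ⟨T', hTT', hcompl⟩ := hdis.exists_isCompl
  have hfr : Module.finrank ℂ T' = n := by
    have e1 := Submodule.finrank_add_eq_of_isCompl hcompl
    have e2 := LinearMap.finrank_range_add_finrank_ker (p₀ : (Fin N → ℂ) →ₗ[ℂ] (Fin n → ℂ))
    have e3 : LinearMap.range (p₀ : (Fin N → ℂ) →ₗ[ℂ] (Fin n → ℂ)) = ⊤ := LinearMap.range_eq_top.2 hsurj
    rw [e3, finrank_top, Module.finrank_fin_fun] at e2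
    omega
  let T'' : Submodule ℂ (EuclideanSpace ℂ (Fin N)) := T'.comap (ψ.toLinearEquiv : EuclideanSpace ℂ (Fin N) →ₗ[ℂ] (Fin N → ℂ))
  have hfr2 : Module.finrank ℂ T'' = n := by
    rw [← hfr]
    exact (LinearEquiv.ofSubmodule' ψ.toLinearEquiv T').finrank_eq
  let b := (stdOrthonormalBasis ℂ T'').reindex (finCongr hfr2)
  let L : EuclideanSpace ℂ (Fin n) →L[ℂ] EuclideanSpace ℂ (Fin N) :=
    T''.subtypeL.comp (b.repr.symm.toContinuousLinearEquiv : EuclideanSpace ℂ (Fin n) →L[ℂ] T'')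
  have hL : L ∈ 𝓚 := by
    intro x
    change ‖((b.repr.symm x : T'') : EuclideanSpace ℂ (Fin N))‖ = ‖x‖
    exact (b.repr.symm.norm_map x)
  obtain ⟨P, hP, hPc⟩ := h2 L hL
  refine ⟨P, hP, fun v hv => ?_⟩
  have hv' : ψ.symm v ∈ T'' := by
    change ψ (ψ.symm v) ∈ T'
    rw [ψ.apply_symm_apply]
    exact hTT' hv
  have hx : L (b.repr ⟨ψ.symm v, hv'⟩) = ψ.symm v := by
    change ((b.repr.symm (b.repr ⟨ψ.symm v, hv'⟩) : T'') : EuclideanSpace ℂ (Fin N)) = _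
    rw [LinearIsometryEquiv.symm_apply_apply]
  have h3 := hPc (b.repr ⟨ψ.symm v, hv'⟩)
  rw [← hL, hx, ψ.apply_symm_apply] at h3
  refine le_trans ?_ h3
  have h4 : ‖v‖ ≤ ‖ψc‖ * ‖ψ.symm v‖ := by
    have := ψc.le_opNorm (ψ.symm v)
    have e : ψc (ψ.symm v) = v := ψ.apply_symm_apply v
    rwa [e] at this
  rw [div_mul_eq_mul_div, div_le_iff₀ (by positivity), mul_assoc]
  gcongr
  nlinarith [norm_nonneg (ψ.symm v)]

end family

section localanti
open Filter Topology Set Metric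
open scoped NNReal

theorem anti_local {E G H : Type*} [NormedAddCommGroup E] [NormedSpace ℂ E]
    [FiniteDimensional ℂ E] [NormedAddCommGroup G] [NormedSpace ℂ G]
    [NormedAddCommGroup H] [NormedSpace ℂ H] (Φ : E → H) (z₀ : E) (L : E →L[ℂ] H)
    (hΦ : HasStrictFDerivAt Φ L z₀) (P : E →L[ℂ] G) (c : ℝ) (hc : 0 < c)
    (hT : ∀ v, L v = 0 → c * ‖v‖ ≤ ‖P v‖) :
    ∃ V ∈ 𝓝 z₀, ∀ a ∈ V, ∀ b ∈ V, Φ a = Φ b → ‖a - b‖ ≤ 2 / c * ‖P a - P b‖ := by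
  obtain ⟨W, hW⟩ := Submodule.exists_isCompl (LinearMap.ker (L : E →ₗ[ℂ] H))
  have hinj : Function.Injective ((L : E →ₗ[ℂ] H).comp W.subtype) := by
    rw [injective_iff_map_eq_zero]
    intro w hw
    have h1 : (w : E) ∈ LinearMap.ker (L : E →ₗ[ℂ] H) := by simpa using hw
    have h2 := Submodule.disjoint_def.1 hW.disjoint _ h1 w.2
    simpa using h2
  obtain ⟨K, hK, hK2⟩ := LinearMap.exists_antilipschitzWith _ (LinearMap.ker_eq_bot.2 hinj)
  have hKw : ∀ w ∈ W, ‖w‖ ≤ K * ‖L w‖ := by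
    intro w hw
    have h3 := hK2.le_mul_dist ⟨w, hw⟩ 0
    rw [map_zero, dist_zero_right, dist_zero_right] at h3
    exact h3
  set ε : ℝ := c / 2 / ((c + ‖P‖) * K) with hε
  have hεpos : 0 < ε := by positivity
  have hlo := hΦ.isLittleO.def hεpos
  rw [nhds_prod_eq] at hlo
  obtain ⟨V, hV, hVV⟩ := Filter.eventually_prod_self_iff
    (r := fun x y => ‖Φ x - Φ y - L (x - y)‖ ≤ ε * ‖x - y‖) |>.1 hlo
  refine ⟨V, hV, fun a ha b hb hab => ?_⟩
  have h1 := hVV a ha b hb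
  simp only [hab, sub_self, zero_sub, norm_neg] at h1
  set v := a - b with hv
  obtain ⟨t, ht, w, hw, htw⟩ := Submodule.mem_sup.1 (show v ∈ (LinearMap.ker (L : E →ₗ[ℂ] H)) ⊔ W by
    rw [hW.sup_eq_top]; trivial)
  have hLt : L t = 0 := by simpa using ht
  have hLw : L v = L w := by rw [← htw, map_add, hLt, zero_add]
  have h2 := hKw w hw
  rw [← hLw] at h2
  have h3 : ‖w‖ ≤ K * (ε * ‖v‖) := h2.trans (by gcongr)
  have h4 := hT t hLt
  have h5 : ‖v‖ ≤ ‖t‖ + ‖w‖ := by rw [← htw]; exact norm_add_le _ _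
  have h6 : ‖P t‖ ≤ ‖P v‖ + ‖P‖ * ‖w‖ := by
    have : P t = P v - P w := by rw [← htw, map_add]; abel
    rw [this]
    exact (norm_sub_le _ _).trans (by gcongr; exact P.le_opNorm w)
  have h7 : (c + ‖P‖) * ‖w‖ ≤ c / 2 * ‖v‖ := by
    calc (c + ‖P‖) * ‖w‖ ≤ (c + ‖P‖) * (K * (ε * ‖v‖)) := by gcongr
      _ = c / 2 * ‖v‖ := by rw [hε]; field_simp
  rw [← map_sub, ← hv, div_mul_eq_mul_div, le_div_iff₀ hc]
  nlinarith

theorem holAt_iterDeriv {n p : ℕ} (A : (Fin n → ℂ) → Polynomial ℂ) (hp : ∀ y, (A y).natDegree = p)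
    (y₀ : Fin n → ℂ) (hA : ∀ k, HolAt (fun y => (A y).coeff k) y₀) (j : ℕ) (t₀ : ℂ) :
    HolAt (fun x : (Fin n → ℂ) × ℂ => (Polynomial.derivative^[j] (A x.1)).eval x.2) (y₀, t₀) := by
  have h1 : ∀ x : (Fin n → ℂ) × ℂ, (Polynomial.derivative^[j] (A x.1)).eval x.2 =
      ∑ i ∈ Finset.range (p + 1), ((i + j).descFactorial j : ℂ) * (A x.1).coeff (i + j) * x.2 ^ i := by
    intro x
    rw [Polynomial.eval_eq_sum_range' (n := p + 1)]
    · simp [Polynomial.coeff_iterate_derivative]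
    · have := Polynomial.natDegree_iterate_derivative (A x.1) j
      rw [hp] at this
      omega
  simp_rw [h1]
  apply HolAt.sum
  intro i _
  refine ((holAt_const _ _).mul ?_).mul ((holAt_of_differentiable differentiable_snd _).pow i)
  exact HolAt.comp (g := fun y => (A y).coeff (i + j)) (f := Prod.fst) (hA _)
    (holAt_of_differentiable differentiable_fst _)

theorem exists_iterDeriv (q : Polynomial ℂ) (hq : q.Monic) (t : ℂ) (ht : q.eval t = 0) :
    ∃ j < q.natDegree, (Polynomial.derivative^[j] q).eval t = 0 ∧
      (Polynomial.derivative^[j+1] q).eval t ≠ 0 := by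
  classical
  have hex : ∃ j, (Polynomial.derivative^[j] q).eval t ≠ 0 ∧ j ≤ q.natDegree := by
    refine ⟨q.natDegree, ?_, le_rfl⟩
    have h1 := Polynomial.natDegree_iterate_derivative q q.natDegree
    rw [Nat.sub_self] at h1
    rw [Polynomial.eq_C_of_natDegree_le_zero h1, Polynomial.eval_C,
      Polynomial.coeff_iterate_derivative, zero_add, hq.coeff_natDegree, Nat.descFactorial_self]
    simp [Nat.factorial_ne_zero]
  have hs := Nat.find_spec hex
  have hm : ∀ j < Nat.find hex, _ := fun j hj => Nat.find_min hex hj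
  generalize Nat.find hex = m at hs hm
  rcases m with _ | m
  · exact absurd ht hs.1
  · refine ⟨m, by omega, ?_, hs.1⟩
    have := hm m (Nat.lt_succ_self m)
    by_contra h
    exact this ⟨h, by omega⟩

end localanti

section volume
open Filter Topology Set Metric
open scoped ENNReal NNReal

theorem haar_two_mul (n : ℕ) :
    (μH[((2 * n : ℕ) : ℝ)] : Measure (Fin n → ℂ)).IsAddHaarMeasure := by
  have h : Module.finrank ℝ (Fin n → ℂ) = 2 * n := by
    rw [Module.finrank_pi_fintype]; simp [mul_comm]
  rw [← h]
  infer_instance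

theorem haus_closedBall (n : ℕ) (ρ : ℝ) (hρ : 0 ≤ ρ) :
    (μH[((2 * n : ℕ) : ℝ)] : Measure (Fin n → ℂ)) (closedBall 0 ρ) =
      ENNReal.ofReal (ρ ^ (2 * n)) * μH[((2 * n : ℕ) : ℝ)] (ball (0 : Fin n → ℂ) 1) := by
  have h : Module.finrank ℝ (Fin n → ℂ) = 2 * n := by
    rw [Module.finrank_pi_fintype]; simp [mul_comm]
  have := haar_two_mul n
  rw [Measure.addHaar_closedBall _ _ hρ, h]

theorem haus_ball_ne_top (n : ℕ) :
    (μH[((2 * n : ℕ) : ℝ)] : Measure (Fin n → ℂ)) (ball 0 1) ≠ ⊤ := by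
  have := haar_two_mul n
  exact measure_ball_lt_top.ne

theorem vol_bound {n N r : ℕ} (f : Fin r → (Fin N → ℂ) → ℂ) (hf : ∀ i, HolAt (f i) 0)
    (p₀ : (Fin N → ℂ) →L[ℂ] (Fin n → ℂ)) (hsurj : Function.Surjective p₀) (C : ℝ) (hC : 0 < C)
    (hcone : ∀ᶠ z in 𝓝 (0 : Fin N → ℂ), (∀ i, f i z = 0) → ‖z‖ ≤ C * ‖p₀ z‖) :
    ∃ (K : ℝ≥0∞) (R : ℝ), K ≠ ⊤ ∧ 0 < R ∧ ∀ ρ, 0 < ρ → ρ ≤ R →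
      IsClosed {z ∈ closedBall (0 : Fin N → ℂ) ρ | ∀ i, f i z = 0} ∧
      μH[((2 * n : ℕ) : ℝ)] {z ∈ closedBall (0 : Fin N → ℂ) ρ | ∀ i, f i z = 0} ≤
        K * ENNReal.ofReal (ρ ^ (2 * n)) := by
  classical
  set δ : ℝ := 1 / (2 * C) with hδ
  have hδpos : 0 < δ := by positivity
  obtain ⟨F, c, hc, hF, hFT⟩ := finite_family p₀ hsurj δ hδpos
  have hiso : ∀ P : (Fin N → ℂ) →L[ℂ] (Fin n → ℂ), ‖P - p₀‖ < δ →
      ∀ᶠ z in 𝓝 (0 : Fin N → ℂ), (∀ i, f i z = 0) → P z = 0 → z = 0 := by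
    intro P hP
    filter_upwards [hcone] with z hz hfz hPz
    have h1 := hz hfz
    have h2 : ‖p₀ z‖ ≤ ‖P - p₀‖ * ‖z‖ := by
      have := (P - p₀).le_opNorm z
      rw [sub_apply, hPz, zero_sub, norm_neg] at this
      exact this
    by_contra hz0
    have hzpos : 0 < ‖z‖ := norm_pos_iff.2 hz0
    have h3 : C * ‖p₀ z‖ < C * (δ * ‖z‖) := by
      have : ‖p₀ z‖ < δ * ‖z‖ := h2.trans_lt (by gcongr)
      gcongr
    have h4 : C * (δ * ‖z‖) = ‖z‖ / 2 := by rw [hδ]; field_simp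
    linarith
  have hpoly := fun (P : (Fin N → ℂ) →L[ℂ] (Fin n → ℂ)) (hP : ‖P - p₀‖ < δ) (k : Fin N) =>
    integral_eq f hf P (ContinuousLinearMap.proj k) (hiso P hP)
  choose p A hmonic hdeg hhol hev using hpoly
  have hp₀ : ‖p₀ - p₀‖ < δ := by simpa using hδpos
  -- radius
  have hcont₀ : ContinuousAt p₀ 0 := p₀.continuous.continuousAt
  have e1 : ∀ᶠ z in 𝓝 (0 : Fin N → ℂ), ∀ i, HolAt (f i) z := eventually_all.2 fun i => (hf i).eventually
  have e2 : ∀ᶠ z in 𝓝 (0 : Fin N → ℂ), ∀ k, ∀ j ∈ Finset.range (p p₀ hp₀ k + 1),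
      HolAt (fun y => (A p₀ hp₀ k y).coeff j) (p₀ z) := by
    refine eventually_all.2 fun k => (eventually_all_finset _).2 fun j _ => ?_
    exact hcont₀.eventually (p := fun y => HolAt (fun y => (A p₀ hp₀ k y).coeff j) y)
      (by rw [map_zero]; exact (hhol p₀ hp₀ k j).eventually)
  have e3 : ∀ᶠ z in 𝓝 (0 : Fin N → ℂ), ∀ P : F, ∀ k, (∀ i, f i z = 0) →
      (A P (hF P P.2) k (P.1 z)).eval (z k) = 0 :=
    eventually_all.2 fun P => eventually_all.2 fun k => hev P (hF P P.2) k
  have e4 : ∀ᶠ z in 𝓝 (0 : Fin N → ℂ), ∀ k, (∀ i, f i z = 0) →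
      (A p₀ hp₀ k (p₀ z)).eval (z k) = 0 :=
    eventually_all.2 fun k => hev p₀ hp₀ k
  obtain ⟨R, hR, hRb⟩ := Metric.nhds_basis_closedBall.eventually_iff.1 (e1.and (e2.and (e3.and e4)))
  have hcoef : ∀ z ∈ closedBall (0 : Fin N → ℂ) R, ∀ k j,
      HolAt (fun y => (A p₀ hp₀ k y).coeff j) (p₀ z) := by
    intro z hz k j
    by_cases hj : j ∈ Finset.range (p p₀ hp₀ k + 1)
    · exact (hRb hz).2.1 k j hj
    · refine (holAt_const 0 _).congr (Eventually.of_forall fun y => ?_)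
      symm
      apply Polynomial.coeff_eq_zero_of_natDegree_lt
      rw [hdeg]
      simpa using hj
  let D : Fin N → ℕ → (Fin N → ℂ) → ℂ := fun k j z =>
    (Polynomial.derivative^[j] (A p₀ hp₀ k (p₀ z))).eval (z k)
  have hD : ∀ z ∈ closedBall (0 : Fin N → ℂ) R, ∀ k j, HolAt (D k j) z := by
    intro z hz k j
    have h1 := holAt_iterDeriv (A p₀ hp₀ k) (hdeg p₀ hp₀ k) (p₀ z) (hcoef z hz k) j (z k)
    refine HolAt.comp (f := fun z : Fin N → ℂ => (p₀ z, z k)) h1 (holAt_of_differentiable ?_ _)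
    have : Differentiable ℂ p₀ := p₀.differentiable
    fun_prop
  have hZcl : ∀ ρ, ρ ≤ R → IsClosed {z ∈ closedBall (0 : Fin N → ℂ) ρ | ∀ i, f i z = 0} := by
    intro ρ hρ
    have hco : ContinuousOn (fun z => fun i => f i z) (closedBall (0 : Fin N → ℂ) ρ) := by
      rw [continuousOn_pi]
      intro i z hz
      exact ((hRb (closedBall_subset_closedBall hρ hz)).1 i).diff.continuousAt.continuousWithinAt
    have h1 := hco.preimage_isClosed_of_isClosed isClosed_closedBall (isClosed_singleton (x := 0))
    convert h1 using 1
    ext z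
    simp [funext_iff]
  set Z : Set (Fin N → ℂ) := {z ∈ closedBall (0 : Fin N → ℂ) R | ∀ i, f i z = 0} with hZ
  have hDm : ∀ k j, MeasurableSet {z ∈ closedBall (0 : Fin N → ℂ) R | D k j z = 0} := by
    intro k j
    have hco : ContinuousOn (D k j) (closedBall (0 : Fin N → ℂ) R) := fun z hz =>
      (hD z hz k j).diff.continuousAt.continuousWithinAt
    exact (hco.preimage_isClosed_of_isClosed isClosed_closedBall
      (isClosed_singleton (x := 0))).measurableSet
  let S : ((k : Fin N) → Fin (p p₀ hp₀ k)) → Set (Fin N → ℂ) := fun J =>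
    {z ∈ Z | ∀ k, D k (J k) z = 0 ∧ D k (J k + 1) z ≠ 0}
  have hSm : ∀ J, MeasurableSet (S J) := by
    intro J
    have : S J = Z ∩ ⋂ k, ({z ∈ closedBall (0 : Fin N → ℂ) R | D k (J k) z = 0} \
        {z ∈ closedBall (0 : Fin N → ℂ) R | D k (J k + 1) z = 0}) := by
      ext z
      simp only [S, mem_ofPred_eq, mem_inter_iff, mem_iInter, Set.mem_sdiff, not_and]
      constructor
      · rintro ⟨hz, h⟩
        exact ⟨hz, fun k => ⟨⟨hz.1, (h k).1⟩, fun _ => (h k).2⟩⟩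
      · rintro ⟨hz, h⟩
        exact ⟨hz, fun k => ⟨(h k).1.2, (h k).2 hz.1⟩⟩
    rw [this]
    exact (hZcl R le_rfl).measurableSet.inter (MeasurableSet.iInter fun k => (hDm k _).diff (hDm k _))
  let O : ((k : Fin N) → Fin (p p₀ hp₀ k)) → ((Fin N → ℂ) →L[ℂ] (Fin n → ℂ)) → Set (Fin N → ℂ) :=
    fun J P => {z | ∃ V ∈ 𝓝 z, ∀ a ∈ S J ∩ V, ∀ b ∈ S J ∩ V, ‖a - b‖ ≤ 2 / c * ‖P a - P b‖}
  have hOo : ∀ J P, IsOpen (O J P) := by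
    intro J P
    rw [isOpen_iff_mem_nhds]
    rintro z ⟨V, hV, hVV⟩
    filter_upwards [eventually_mem_nhds_iff.2 hV] with w hw
    exact ⟨V, hw, hVV⟩
  have hcov : ∀ z ∈ Z, ∃ J, z ∈ S J ∧ ∃ P ∈ F, z ∈ O J P := by
    intro z hz
    have h1 : ∀ k, ∃ j : Fin (p p₀ hp₀ k), D k j z = 0 ∧ D k (j + 1) z ≠ 0 := by
      intro k
      obtain ⟨j, hj, hj1, hj2⟩ := exists_iterDeriv _ (hmonic p₀ hp₀ k (p₀ z)) (z k)
        ((hRb hz.1).2.2.2 k hz.2)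
      rw [hdeg] at hj
      exact ⟨⟨j, hj⟩, hj1, hj2⟩
    choose J hJ using h1
    have hzS : z ∈ S J := ⟨hz, hJ⟩
    refine ⟨J, hzS, ?_⟩
    let L : (Fin N → ℂ) →L[ℂ] (Fin N → ℂ) := ContinuousLinearMap.pi fun k => fderiv ℂ (D k (J k)) z
    have hΦ : HasStrictFDerivAt (fun z => fun k => D k (J k) z) L z := by
      rw [hasStrictFDerivAt_pi']
      intro k
      exact (hD z hz.1 k (J k)).hasStrictFDerivAt
    obtain ⟨P, hPF, hPc⟩ := hFT (LinearMap.ker (L : (Fin N → ℂ) →ₗ[ℂ] (Fin N → ℂ))) (by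
      intro v hv hpv
      have hLv : L v = 0 := by simpa using hv
      ext k
      have h2 : fderiv ℂ (D k (J k)) z v = 0 := congrFun hLv k
      have hline : HasDerivAt (fun s : ℂ => z + s • v) v 0 := by
        have := ((hasDerivAt_id (0:ℂ)).smul_const v).const_add z
        simpa using this
      have h3 : HasDerivAt (fun s : ℂ => D k (J k) (z + s • v)) (fderiv ℂ (D k (J k)) z v) 0 := by
        have hd := (hD z hz.1 k (J k)).diff.hasFDerivAt
        have hd' : HasFDerivAt (D k (J k)) (fderiv ℂ (D k (J k)) z) (z + (0:ℂ) • v) := by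
          simpa using hd
        exact hd'.comp_hasDerivAt (0:ℂ) hline
      have h4 : ∀ s : ℂ, D k (J k) (z + s • v) =
          (Polynomial.derivative^[J k] (A p₀ hp₀ k (p₀ z))).eval (z k + s * v k) := by
        intro s
        simp [D, hpv]
      have h5 : HasDerivAt (fun s : ℂ => D k (J k) (z + s • v)) (D k (J k + 1) z * v k) 0 := by
        simp_rw [h4]
        have hq := (Polynomial.derivative^[J k] (A p₀ hp₀ k (p₀ z))).hasDerivAt (z k + 0 * v k)
        have hi : HasDerivAt (fun s : ℂ => z k + s * v k) (v k) 0 := by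
          have := ((hasDerivAt_id (0:ℂ)).mul_const (v k)).const_add (z k)
          simpa using this
        have := HasDerivAt.comp (0:ℂ) hq hi
        simpa [D, Function.iterate_succ_apply', Function.comp_def] using this
      have h6 := h3.unique h5
      rw [h2] at h6
      have := mul_eq_zero.1 h6.symm
      exact this.resolve_left (hJ k).2)
    obtain ⟨V, hV, hVV⟩ := anti_local _ z L hΦ P c hc (fun v hv => hPc v (by simpa using hv))
    refine ⟨P, hPF, V, hV, fun a ha b hb => hVV a ha.2 b hb.2 ?_⟩
    funext k
    exact (ha.1.2 k).1.trans (hb.1.2 k).1.symm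
  let κ : ℝ≥0 := (2 / c).toNNReal
  let d : F → ℕ := fun P => ∏ k, p P (hF P P.2) k
  let K : ℝ≥0∞ := ∑ J : ((k : Fin N) → Fin (p p₀ hp₀ k)), ∑ P : F,
    (κ : ℝ≥0∞) ^ ((2 * n : ℕ) : ℝ) * (d P * (ENNReal.ofReal (‖P.1‖ ^ (2 * n)) *
      μH[((2 * n : ℕ) : ℝ)] (ball (0 : Fin n → ℂ) 1)))
  refine ⟨K, R, ?_, hR, fun ρ hρ hρR => ⟨hZcl ρ hρR, ?_⟩⟩
  · refine ENNReal.sum_ne_top.2 fun J _ => ENNReal.sum_ne_top.2 fun P _ => ?_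
    refine ENNReal.mul_ne_top (ENNReal.rpow_ne_top_of_nonneg (by positivity) ENNReal.coe_ne_top) ?_
    refine ENNReal.mul_ne_top (ENNReal.natCast_ne_top _) (ENNReal.mul_ne_top ENNReal.ofReal_ne_top ?_)
    exact haus_ball_ne_top n
  · have hpiece : ∀ J, ∀ P : F, μH[((2 * n : ℕ) : ℝ)] (S J ∩ O J P ∩ closedBall 0 ρ) ≤
        (κ : ℝ≥0∞) ^ ((2 * n : ℕ) : ℝ) * (d P * (ENNReal.ofReal (‖P.1‖ ^ (2 * n)) *
          μH[((2 * n : ℕ) : ℝ)] (ball (0 : Fin n → ℂ) 1))) * ENNReal.ofReal (ρ ^ (2 * n)) := by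
      intro J P
      have hb := measure_fibre_bound (S := S J ∩ O J P ∩ closedBall 0 ρ)
        (((hSm J).inter (hOo J P).measurableSet).inter isClosed_closedBall.measurableSet)
        (P := P.1) P.1.continuous κ (d P) ?_ ?_ (B := closedBall 0 (‖P.1‖ * ρ)) ?_
        ((2 * n : ℕ) : ℝ) (by positivity)
      · refine hb.trans (le_of_eq ?_)
        rw [haus_closedBall _ _ (by positivity), mul_pow, ENNReal.ofReal_mul (by positivity)]
        ring
      · rintro z ⟨⟨hzS, V, hV, hVV⟩, -⟩
        refine ⟨V, hV, fun a ha b hb => ?_⟩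
        have h1 := hVV a ⟨ha.1.1.1, ha.2⟩ b ⟨hb.1.1.1, hb.2⟩
        rw [edist_dist, edist_dist, dist_eq_norm, dist_eq_norm, ← ENNReal.ofReal_coe_nnreal,
          ← ENNReal.ofReal_mul (by positivity)]
        apply ENNReal.ofReal_le_ofReal
        rwa [Real.coe_toNNReal _ (by positivity)]
      · intro y
        have hsub : S J ∩ O J P ∩ closedBall 0 ρ ∩ P.1 ⁻¹' {y} ⊆
            ((Fintype.piFinset fun k => (A P (hF P P.2) k y).roots.toFinset : Finset (Fin N → ℂ)) :
              Set (Fin N → ℂ)) := by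
          rintro z ⟨⟨⟨hzS, -⟩, -⟩, hzy⟩
          have hzy' : P.1 z = y := hzy
          rw [Finset.mem_coe, Fintype.mem_piFinset]
          intro k
          rw [Multiset.mem_toFinset, Polynomial.mem_roots (hmonic P (hF P P.2) k y).ne_zero]
          have := (hRb hzS.1.1).2.2.1 P k hzS.1.2
          rwa [hzy'] at this
        refine (Set.encard_le_encard hsub).trans ?_
        rw [Set.encard_coe_eq_coe_finsetCard, Fintype.card_piFinset]
        have : ∏ k, ((A P (hF P P.2) k y).roots.toFinset).card ≤ d P := by
          apply Finset.prod_le_prod' 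
          intro k _
          refine (Multiset.toFinset_card_le _).trans ((Polynomial.card_roots' _).trans ?_)
          rw [hdeg]
        exact_mod_cast this
      · rintro z ⟨-, hz⟩
        rw [mem_closedBall, dist_zero_right] at hz ⊢
        exact (P.1.le_opNorm z).trans (by gcongr)
    have hsub : {z ∈ closedBall (0 : Fin N → ℂ) ρ | ∀ i, f i z = 0} ⊆
        ⋃ J, ⋃ P : F, (S J ∩ O J P ∩ closedBall 0 ρ) := by
      rintro z ⟨hz, hfz⟩
      obtain ⟨J, hJ, P, hP, hzO⟩ := hcov z ⟨closedBall_subset_closedBall hρR hz, hfz⟩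
      exact mem_iUnion.2 ⟨J, mem_iUnion.2 ⟨⟨P, hP⟩, ⟨hJ, hzO⟩, hz⟩⟩
    calc _ ≤ _ := measure_mono hsub
      _ ≤ ∑ J, μH[((2 * n : ℕ) : ℝ)] (⋃ P : F, (S J ∩ O J P ∩ closedBall 0 ρ)) :=
          measure_iUnion_fintype_le _ _
      _ ≤ ∑ J, ∑ P : F, μH[((2 * n : ℕ) : ℝ)] (S J ∩ O J P ∩ closedBall 0 ρ) :=
          Finset.sum_le_sum fun J _ => measure_iUnion_fintype_le _ _
      _ ≤ ∑ J : ((k : Fin N) → Fin (p p₀ hp₀ k)), ∑ P : F, (κ : ℝ≥0∞) ^ ((2 * n : ℕ) : ℝ) * (d P * (ENNReal.ofReal (‖P.1‖ ^ (2 * n)) *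
          μH[((2 * n : ℕ) : ℝ)] (ball (0 : Fin n → ℂ) 1))) * ENNReal.ofReal (ρ ^ (2 * n)) :=
          Finset.sum_le_sum fun J _ => Finset.sum_le_sum fun P _ => hpiece J P
      _ = K * ENNReal.ofReal (ρ ^ (2 * n)) := by
          simp only [K, Finset.sum_mul]

end volume

section final
open Filter Topology Set Metric
open scoped ENNReal NNReal

/-- the dyadic summation -/
theorem dyadic_sum {N n : ℕ} (X : Set (Fin N → ℂ)) (μ : Measure (Fin N → ℂ)) (K : ℝ≥0∞) (R : ℝ)
    (hK : K ≠ ⊤) (hR : 0 < R)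
    (hvol : ∀ ρ, 0 < ρ → ρ ≤ R → MeasurableSet (X ∩ closedBall 0 ρ) ∧
      μ (X ∩ closedBall 0 ρ) ≤ K * ENNReal.ofReal (ρ ^ (2 * n)))
    (g : (Fin N → ℂ) → ℝ) (hg0 : g 0 = 0) (M : ℝ) (hM : 0 ≤ M)
    (hg : ∀ z ∈ X ∩ closedBall 0 R, z ≠ 0 → g z ≤ M * ‖z‖ ^ 2 / ‖z‖ ^ (2 * n)) :
    ∫⁻ z in X ∩ closedBall 0 R, ENNReal.ofReal (g z) ∂μ < ⊤ := by
  let ρ : ℕ → ℝ := fun j => R * (1 / 2) ^ j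
  have hρpos : ∀ j, 0 < ρ j := fun j => by positivity
  have hρle : ∀ j, ρ j ≤ R := fun j => by
    have : (1 / 2 : ℝ) ^ j ≤ 1 := pow_le_one₀ (by norm_num) (by norm_num)
    exact mul_le_of_le_one_right hR.le this
  let A : ℕ → Set (Fin N → ℂ) := fun j => (X ∩ closedBall 0 (ρ j)) \ closedBall 0 (ρ j / 2)
  have hAm : ∀ j, MeasurableSet (A j) := fun j =>
    (hvol _ (hρpos j) (hρle j)).1.diff isClosed_closedBall.measurableSet
  have hcov : X ∩ closedBall 0 R ⊆ {0} ∪ ⋃ j, A j := by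
    rintro z ⟨hzX, hz⟩
    by_cases hz0 : z = 0
    · left; exact hz0
    · right
      have hzpos : 0 < ‖z‖ := norm_pos_iff.2 hz0
      rw [mem_closedBall, dist_zero_right] at hz
      obtain ⟨j, hj1, hj2⟩ := exists_nat_pow_near_of_lt_one (x := ‖z‖ / R) (y := (1 / 2 : ℝ))
        (by positivity) ((div_le_one hR).2 hz) (by norm_num) (by norm_num)
      rw [lt_div_iff₀ hR, pow_succ] at hj1
      rw [div_le_iff₀ hR] at hj2
      refine mem_iUnion.2 ⟨j, ⟨hzX, ?_⟩, ?_⟩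
      · rw [mem_closedBall, dist_zero_right]
        simp only [ρ]
        linarith
      · rw [mem_closedBall, dist_zero_right, not_le]
        simp only [ρ]
        linarith
  have hpiece : ∀ j, ∫⁻ z in A j, ENNReal.ofReal (g z) ∂μ ≤
      K * ENNReal.ofReal (M * 4 ^ n * R ^ 2 * (1 / 4) ^ j) := by
    intro j
    have hb : ∀ z ∈ A j, ENNReal.ofReal (g z) ≤
        ENNReal.ofReal (M * ρ j ^ 2 / (ρ j / 2) ^ (2 * n)) := by
      rintro z ⟨⟨hzX, hz1⟩, hz2⟩
      rw [mem_closedBall, dist_zero_right] at hz1 hz2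
      rw [not_le] at hz2
      have hzpos : 0 < ‖z‖ := lt_trans (half_pos (hρpos j)) hz2
      have hρ2 : 0 < ρ j / 2 := half_pos (hρpos j)
      apply ENNReal.ofReal_le_ofReal
      refine (hg z ⟨hzX, ?_⟩ (norm_pos_iff.1 hzpos)).trans ?_
      · rw [mem_closedBall, dist_zero_right]
        exact hz1.trans (hρle j)
      · gcongr
    calc ∫⁻ z in A j, ENNReal.ofReal (g z) ∂μ
        ≤ ∫⁻ z in A j, ENNReal.ofReal (M * ρ j ^ 2 / (ρ j / 2) ^ (2 * n)) ∂μ :=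
          setLIntegral_mono' (hAm j) hb
      _ = ENNReal.ofReal (M * ρ j ^ 2 / (ρ j / 2) ^ (2 * n)) * μ (A j) := setLIntegral_const _ _
      _ ≤ ENNReal.ofReal (M * ρ j ^ 2 / (ρ j / 2) ^ (2 * n)) *
          (K * ENNReal.ofReal (ρ j ^ (2 * n))) := by
          gcongr
          exact (measure_mono diff_subset).trans (hvol _ (hρpos j) (hρle j)).2
      _ = K * ENNReal.ofReal (M * ρ j ^ 2 / (ρ j / 2) ^ (2 * n) * ρ j ^ (2 * n)) := by
          have := hρpos j
          rw [ENNReal.ofReal_mul (by positivity)]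
          ring
      _ = _ := by
          congr 2
          have h1 : ρ j ^ (2 * n) ≠ 0 := (pow_pos (hρpos j) _).ne'
          have h2 : ρ j ^ 2 = R ^ 2 * (1 / 4) ^ j := by
            simp only [ρ]
            rw [mul_pow, ← pow_mul, mul_comm j 2, pow_mul]
            norm_num
          have h3 : (2:ℝ) ^ (2 * n) = 4 ^ n := by rw [pow_mul]; norm_num
          rw [div_pow, h2, h3]
          field_simp
  have hsum : ∑' j : ℕ, K * ENNReal.ofReal (M * 4 ^ n * R ^ 2 * (1 / 4) ^ j) < ⊤ := by
    rw [ENNReal.tsum_mul_left]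
    refine ENNReal.mul_lt_top hK.lt_top ?_
    rw [← ENNReal.ofReal_tsum_of_nonneg (fun j => by positivity)
      ((summable_geometric_of_lt_one (by norm_num) (by norm_num)).mul_left _)]
    exact ENNReal.ofReal_lt_top
  calc ∫⁻ z in X ∩ closedBall 0 R, ENNReal.ofReal (g z) ∂μ
      ≤ ∫⁻ z in {0} ∪ ⋃ j, A j, ENNReal.ofReal (g z) ∂μ := lintegral_mono_set hcov
    _ ≤ ∫⁻ z in {0}, ENNReal.ofReal (g z) ∂μ + ∫⁻ z in ⋃ j, A j, ENNReal.ofReal (g z) ∂μ :=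
        lintegral_union_le _ _ _
    _ ≤ 0 + ∑' j, ∫⁻ z in A j, ENNReal.ofReal (g z) ∂μ := by
        gcongr
        · rw [lintegral_singleton, hg0]; simp
        · exact lintegral_iUnion_le _ _
    _ ≤ ∑' j : ℕ, K * ENNReal.ofReal (M * 4 ^ n * R ^ 2 * (1 / 4) ^ j) := by
        rw [zero_add]
        exact ENNReal.tsum_le_tsum hpiece
    _ < ⊤ := hsum

end final

theorem stmt19 (n N : ℕ) (hnN : n < N) (D : Set (Fin N → ℂ)) (hD : IsOpen D)
    (X : Set (Fin N → ℂ)) (hX : IsAnalyticIn X D) (h0X : (0 : Fin N → ℂ) ∈ X)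
    (hdim : IsPureDimensional X n) (C : ℝ) (hC : 0 < C)
    (W : Set (Fin N → ℂ)) (hW : W ∈ nhds (0 : Fin N → ℂ))
    (hbound : ∀ z ∈ X ∩ W,
      (∑ i ∈ Finset.univ.filter (fun i : Fin N => n ≤ (i : ℕ)), ‖z i‖ ^ 2 : ℝ) ≤
        C ^ 2 * ∑ i ∈ Finset.univ.filter (fun i : Fin N => (i : ℕ) < n), ‖z i‖ ^ 2) :
    ∀ k : Fin N, n ≤ (k : ℕ) →
      ∃ U ∈ nhds (0 : Fin N → ℂ),
        ∫⁻ z in X ∩ U, ENNReal.ofReal (‖z k‖ ^ 2 /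
            (∑ i ∈ Finset.univ.filter (fun i : Fin N => (i : ℕ) < n), ‖z i‖ ^ 2 : ℝ) ^ n)
          ∂(μH[(2 * n : ℕ)]) < ⊤ := by
  intro k hk
  obtain ⟨hXD, hloc⟩ := hX
  obtain ⟨U, hU, hUD, r, f, hf, hXU⟩ := hloc 0 (hXD h0X)
  have hfh : ∀ i, HolAt (f i) 0 := by
    intro i
    filter_upwards [eventually_mem_nhds_iff.2 hU] with y hy
    exact (hf i).differentiableAt hy
  let p₀ : (Fin N → ℂ) →L[ℂ] (Fin n → ℂ) :=
    ContinuousLinearMap.pi fun i => ContinuousLinearMap.proj (Fin.castLE hnN.le i)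
  have hp₀ : ∀ z i, p₀ z i = z (Fin.castLE hnN.le i) := fun z i => rfl
  have hsurj : Function.Surjective p₀ := by
    intro y
    refine ⟨fun j => if h : (j : ℕ) < n then y ⟨j, h⟩ else 0, ?_⟩
    ext i
    rw [hp₀]
    simp
  set s : (Fin N → ℂ) → ℝ := fun z =>
    ∑ i ∈ Finset.univ.filter (fun i : Fin N => (i : ℕ) < n), ‖z i‖ ^ 2 with hs
  have hs0 : ∀ z, 0 ≤ s z := fun z => Finset.sum_nonneg fun i _ => by positivity
  have hzs : ∀ z ∈ X ∩ W, ‖z‖ ^ 2 ≤ (1 + C ^ 2) * s z := by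
    intro z hz
    have hb : _ ≤ C ^ 2 * s z := hbound z hz
    have hi : ∀ i, ‖z i‖ ^ 2 ≤ (1 + C ^ 2) * s z := by
      intro i
      by_cases hin : (i : ℕ) < n
      · have h1 : ‖z i‖ ^ 2 ≤ s z := Finset.single_le_sum (f := fun i => ‖z i‖ ^ 2)
          (fun i _ => by positivity) (by simpa using hin)
        nlinarith [sq_nonneg C, hs0 z]
      · have h1 : ‖z i‖ ^ 2 ≤ ∑ i ∈ Finset.univ.filter (fun i : Fin N => n ≤ (i : ℕ)), ‖z i‖ ^ 2 :=
          Finset.single_le_sum (f := fun i => ‖z i‖ ^ 2)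
          (fun i _ => by positivity) (by simpa using hin)
        nlinarith [sq_nonneg C, hs0 z]
    have h2 : ‖z‖ ≤ Real.sqrt ((1 + C ^ 2) * s z) :=
      (pi_norm_le_iff_of_nonneg (Real.sqrt_nonneg _)).2 fun i => Real.le_sqrt_of_sq_le (hi i)
    have h3 : 0 ≤ (1 + C ^ 2) * s z := mul_nonneg (by positivity) (hs0 z)
    calc ‖z‖ ^ 2 ≤ Real.sqrt ((1 + C ^ 2) * s z) ^ 2 := by gcongr
      _ = _ := Real.sq_sqrt h3
  have hsp : ∀ z, s z ≤ N * ‖p₀ z‖ ^ 2 := by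
    intro z
    calc s z ≤ ∑ i ∈ Finset.univ.filter (fun i : Fin N => (i : ℕ) < n), ‖p₀ z‖ ^ 2 := by
          apply Finset.sum_le_sum
          intro i hi
          have hi' : (i : ℕ) < n := by simpa using hi
          have := norm_le_pi_norm (p₀ z) ⟨i, hi'⟩
          rw [hp₀] at this
          gcongr
          exact this
      _ ≤ ∑ i : Fin N, ‖p₀ z‖ ^ 2 :=
          Finset.sum_le_sum_of_subset_of_nonneg (Finset.filter_subset _ _)
            (fun i _ _ => by positivity)
      _ = N * ‖p₀ z‖ ^ 2 := by simp
  have hN : (1 : ℝ) ≤ N := by exact_mod_cast (by omega : 1 ≤ N)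
  have hcone : ∀ᶠ z in nhds (0 : Fin N → ℂ), (∀ i, f i z = 0) →
      ‖z‖ ≤ ((1 + C ^ 2) * N) * ‖p₀ z‖ := by
    filter_upwards [hU, hW] with z hzU hzW hfz
    have hzX : z ∈ X := by
      have : z ∈ X ∩ U := by rw [hXU]; exact ⟨hzU, hfz⟩
      exact this.1
    have h1 := hzs z ⟨hzX, hzW⟩
    have h2 := hsp z
    have h3 : (1 : ℝ) ≤ (1 + C ^ 2) * N := by nlinarith [sq_nonneg C]
    have h4 : ‖z‖ ^ 2 ≤ ((1 + C ^ 2) * N) * ‖p₀ z‖ ^ 2 := by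
      calc ‖z‖ ^ 2 ≤ (1 + C ^ 2) * s z := h1
        _ ≤ (1 + C ^ 2) * (N * ‖p₀ z‖ ^ 2) := by gcongr
        _ = _ := by ring
    have h5 : ‖z‖ ^ 2 ≤ (((1 + C ^ 2) * N) * ‖p₀ z‖) ^ 2 := by
      refine h4.trans ?_
      rw [mul_pow]
      gcongr
      nlinarith
    exact (pow_le_pow_iff_left₀ (by positivity) (by positivity) two_ne_zero).1 h5
  obtain ⟨K, R, hK, hR, hvol⟩ := vol_bound f hfh p₀ hsurj ((1 + C ^ 2) * N) (by positivity) hcone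
  obtain ⟨R', hR', hR'b⟩ := Metric.nhds_basis_closedBall.mem_iff.1 (Filter.inter_mem hU hW)
  set R₁ := min R R' with hR₁
  have hR₁pos : 0 < R₁ := lt_min hR hR'
  have hXρ : ∀ ρ ≤ R₁, X ∩ Metric.closedBall 0 ρ =
      {z ∈ Metric.closedBall (0 : Fin N → ℂ) ρ | ∀ i, f i z = 0} := by
    intro ρ hρ
    ext z
    constructor
    · rintro ⟨hzX, hz⟩
      have hzU := (hR'b (Metric.closedBall_subset_closedBall (hρ.trans (min_le_right _ _)) hz)).1
      have : z ∈ X ∩ U := ⟨hzX, hzU⟩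
      rw [hXU] at this
      exact ⟨hz, this.2⟩
    · rintro ⟨hz, hfz⟩
      have hzU := (hR'b (Metric.closedBall_subset_closedBall (hρ.trans (min_le_right _ _)) hz)).1
      have : z ∈ X ∩ U := by rw [hXU]; exact ⟨hzU, hfz⟩
      exact ⟨this.1, hz⟩
  refine ⟨Metric.closedBall 0 R₁, Metric.closedBall_mem_nhds _ hR₁pos, ?_⟩
  refine dyadic_sum (n := n) X _ K R₁ hK hR₁pos ?_ _ ?_ ((1 + C ^ 2) ^ n) (by positivity) ?_
  · intro ρ hρ hρR
    rw [hXρ ρ hρR]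
    have := hvol ρ hρ (hρR.trans (min_le_left _ _))
    exact ⟨this.1.measurableSet, this.2⟩
  · simp
  · rintro z ⟨hzX, hz⟩ hz0
    have hzW := (hR'b (Metric.closedBall_subset_closedBall (min_le_right _ _) hz)).2
    have hzpos : 0 < ‖z‖ := norm_pos_iff.2 hz0
    have h1 := hzs z ⟨hzX, hzW⟩
    have hspos : 0 < s z := by
      by_contra h
      have : s z = 0 := le_antisymm (not_lt.1 h) (hs0 z)
      rw [this, mul_zero] at h1
      nlinarith [pow_pos hzpos 2]
    change ‖z k‖ ^ 2 / s z ^ n ≤ _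
    have hzk : ‖z k‖ ≤ ‖z‖ := norm_le_pi_norm z k
    have h2 : ‖z‖ ^ (2 * n) ≤ (1 + C ^ 2) ^ n * s z ^ n := by
      rw [pow_mul, ← mul_pow]
      gcongr
    rw [div_le_div_iff₀ (by positivity) (by positivity)]
    calc ‖z k‖ ^ 2 * ‖z‖ ^ (2 * n) ≤ ‖z‖ ^ 2 * ((1 + C ^ 2) ^ n * s z ^ n) := by gcongr
      _ = _ := by ring
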